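/- arXiv:1611.10275 — 2 statements merged into one kernel-verified Lean document; each statement's English description precedes it below -/
import Mathlib

section
/- For every p ∈ [2,6] and every ε > 0 there is a constant c(ε,p) > 0 such that, whenever R is sufficiently large (depending on ε and p) and N is a positive integer with N < R^{1/2}, one has ‖Ef_{R,N}‖_{L^p(B_R)} ≥ c(ε,p) · R^{3/(2p) - 1/2 - ε} · N^{1/p - 1/2}. -/
open MeasureTheory Real Set ENNReal

noncomputable section

/-- The extension operator: `Ef(x,t) = ∫_{[-1,1]} e^{i(ω²t + ωx)} f(ω) dω`,
viewed as a function on `ℝ × ℝ` with `z = (x, t)`. -/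
def extOp (f : ℝ → ℂ) : ℝ × ℝ → ℂ := fun z =>
  ∫ ω in Icc (-1 : ℝ) 1, Complex.exp (Complex.I * ((ω ^ 2 * z.2 + ω * z.1 : ℝ) : ℂ)) * f ω

/-- The `L²` norm of a function on `ℝ`. -/
def L2norm (f : ℝ → ℂ) : ℝ := (eLpNorm f 2 volume).toReal

/-- The `Lᵖ` norm over the ball of radius `R` centered at the origin of `ℝ²`. -/
def LpBall (g : ℝ × ℝ → ℂ) (p R : ℝ) : ℝ≥0∞ :=
  eLpNorm g (ENNReal.ofReal p) (volume.restrict (Metric.ball (0 : ℝ × ℝ) R))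

/-- The bump `Θ` of the bundle scenario: smooth, `0 ≤ Θ ≤ 1`, identically `1` on
`[-(1/2)R^{-1/2}N⁻¹, (1/2)R^{-1/2}N⁻¹]`, and supported in
`[-R^{-1/2}N⁻¹, R^{-1/2}N⁻¹]`. -/
def IsBundleBump (R : ℝ) (N : ℕ) (Θ : ℝ → ℝ) : Prop :=
  ContDiff ℝ (⊤ : ℕ∞) Θ ∧ (∀ ω, 0 ≤ Θ ω ∧ Θ ω ≤ 1) ∧
    (∀ ω : ℝ, |ω| ≤ 1 / 2 * R ^ (-(1 : ℝ) / 2) * (N : ℝ)⁻¹ → Θ ω = 1) ∧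
    Function.support Θ ⊆
      Icc (-(R ^ (-(1 : ℝ) / 2) * (N : ℝ)⁻¹)) (R ^ (-(1 : ℝ) / 2) * (N : ℝ)⁻¹)

/-- The bundle-scenario function `f_{R,N}(ω) = Σ_{n=-N}^{N} Θ(ω - nR^{-1/2})`. -/
def bundleFn (R : ℝ) (N : ℕ) (Θ : ℝ → ℝ) : ℝ → ℂ := fun ω =>
  ((∑ n ∈ Finset.Icc (-(N : ℤ)) (N : ℤ), Θ (ω - (n : ℝ) * R ^ (-(1 : ℝ) / 2)) : ℝ) : ℂ)

/-- The space-time rectangle `[0, X] × [0, T]`. -/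
def box (X T : ℝ) : Set (ℝ × ℝ) := Icc 0 X ×ˢ Icc 0 T

/-- The plane wave on the parabola with frequency `ω`. -/
def planeWave (ω : ℝ) (z : ℝ × ℝ) : ℂ :=
  Complex.exp (Complex.I * ((ω ^ 2 * z.2 + ω * z.1 : ℝ) : ℂ))

lemma isCompact_box (X T : ℝ) : IsCompact (box X T) := isCompact_Icc.prod isCompact_Icc

lemma volume_box {X T : ℝ} (hX : 0 ≤ X) : volume (box X T) = ENNReal.ofReal (X * T) := by
  rw [box, Measure.volume_eq_prod, Measure.prod_prod, Real.volume_Icc, Real.volume_Icc, sub_zero,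
    sub_zero, ENNReal.ofReal_mul hX]

lemma volume_real_box {X T : ℝ} (hX : 0 ≤ X) (hT : 0 ≤ T) :
    volume.real (box X T) = X * T := by
  rw [Measure.real, volume_box hX, ENNReal.toReal_ofReal (mul_nonneg hX hT)]

@[fun_prop]
lemma continuous_planeWave : Continuous (fun q : ℝ × (ℝ × ℝ) => planeWave q.1 q.2) := by
  unfold planeWave
  fun_prop

@[fun_prop]
lemma continuous_planeWave_right (ω : ℝ) : Continuous (planeWave ω) := by
  unfold planeWave
  fun_prop

lemma planeWave_mul_conj (ω η : ℝ) (z : ℝ × ℝ) :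
    planeWave ω z * (starRingEnd ℂ) (planeWave η z) =
      Complex.exp (Complex.I * (((ω ^ 2 - η ^ 2) * z.2 + (ω - η) * z.1 : ℝ) : ℂ)) := by
  unfold planeWave
  rw [← Complex.exp_conj, ← Complex.exp_add]
  congr 1
  simp only [map_mul, Complex.conj_I, Complex.conj_ofReal]
  push_cast
  ring

lemma norm_exp_I_mul_ofReal (x : ℝ) : ‖Complex.exp (Complex.I * (x : ℂ))‖ = 1 := by
  rw [mul_comm, Complex.norm_exp_ofReal_mul_I]

/-- Oscillatory integrals over a box gain from a nonzero spatial frequency. -/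
lemma norm_setIntegral_box_exp_le {X T : ℝ} (hX : 0 ≤ X) (hT : 0 ≤ T) (a : ℝ) {b : ℝ}
    (hb : b ≠ 0) :
    ‖∫ z in box X T, Complex.exp (Complex.I * ((a * z.2 + b * z.1 : ℝ) : ℂ))‖ ≤ 2 / |b| * T := by
  have hsplit : ∀ z : ℝ × ℝ, Complex.exp (Complex.I * ((a * z.2 + b * z.1 : ℝ) : ℂ)) =
      Complex.exp (Complex.I * ((b * z.1 : ℝ) : ℂ)) *
        Complex.exp (Complex.I * ((a * z.2 : ℝ) : ℂ)) := by
    intro z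
    rw [← Complex.exp_add]
    congr 1
    push_cast
    ring
  simp_rw [hsplit]
  rw [box, Measure.volume_eq_prod, setIntegral_prod_mul
    (fun x : ℝ => Complex.exp (Complex.I * ((b * x : ℝ) : ℂ)))
    (fun t : ℝ => Complex.exp (Complex.I * ((a * t : ℝ) : ℂ))), norm_mul]
  have hc : Complex.I * (b : ℂ) ≠ 0 := mul_ne_zero Complex.I_ne_zero (by exact_mod_cast hb)
  gcongr
  · rw [integral_Icc_eq_integral_Ioc, ← intervalIntegral.integral_of_le hX]
    have h := integral_exp_mul_complex (a := 0) (b := X) hc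
    have he : ∀ x : ℝ, Complex.I * ((b * x : ℝ) : ℂ) = Complex.I * (b : ℂ) * (x : ℂ) := by
      intro x; push_cast; ring
    simp_rw [he]
    rw [h, norm_div, norm_mul, Complex.norm_I, one_mul, Complex.norm_real, Real.norm_eq_abs]
    gcongr
    refine (norm_sub_le _ _).trans ?_
    rw [← he, ← he, norm_exp_I_mul_ofReal, norm_exp_I_mul_ofReal]
    norm_num
  · refine (norm_setIntegral_le_of_norm_le_const (C := 1) (by simp) ?_).trans ?_
    · intro t _
      rw [norm_exp_I_mul_ofReal]
    · simp [Measure.real, hT]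

lemma norm_setIntegral_box_exp_le_area {X T : ℝ} (hX : 0 ≤ X) (hT : 0 ≤ T) (a b : ℝ) :
    ‖∫ z in box X T, Complex.exp (Complex.I * ((a * z.2 + b * z.1 : ℝ) : ℂ))‖ ≤ X * T := by
  refine (norm_setIntegral_le_of_norm_le_const (C := 1)
    (isCompact_box X T).measure_lt_top ?_).trans ?_
  · intro z _
    rw [norm_exp_I_mul_ofReal]
  · rw [volume_real_box hX hT, one_mul]

/-- When the phase stays below `1/2` on the box there is no cancellation. -/
lemma le_re_setIntegral_box_exp {X T : ℝ} (hX : 0 ≤ X) (hT : 0 ≤ T) {a b : ℝ}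
    (h : |a| * T + |b| * X ≤ 1 / 2) :
    3 / 4 * (X * T) ≤
      (∫ z in box X T, Complex.exp (Complex.I * ((a * z.2 + b * z.1 : ℝ) : ℂ))).re := by
  have hint : IntegrableOn
      (fun z : ℝ × ℝ => Complex.exp (Complex.I * ((a * z.2 + b * z.1 : ℝ) : ℂ))) (box X T) :=
    (by fun_prop : Continuous _).continuousOn.integrableOn_compact (isCompact_box X T)
  have hre := integral_re (𝕜 := ℂ) hint
  simp only [RCLike.re_to_complex] at hre
  rw [← hre]
  calc 3 / 4 * (X * T) = ∫ z in box X T, (3 / 4 : ℝ) := by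
        rw [setIntegral_const, volume_real_box hX hT, smul_eq_mul, mul_comm]
    _ ≤ _ := by
      refine setIntegral_mono_on (integrableOn_const (isCompact_box X T).measure_lt_top.ne)
        hint.re (isCompact_box X T).measurableSet ?_
      rintro ⟨x, t⟩ ⟨⟨hx0, hx1⟩, ht0, ht1⟩
      simp only
      rw [mul_comm, Complex.exp_ofReal_mul_I_re]
      have hph : |a * t + b * x| ≤ 1 / 2 := by
        refine (abs_add_le _ _).trans (le_trans ?_ h)
        rw [abs_mul, abs_mul, abs_of_nonneg ht0, abs_of_nonneg hx0]
        dsimp at ht1 hx1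
        gcongr
      have hsq : (a * t + b * x) ^ 2 ≤ (1 / 2) ^ 2 := sq_le_sq' (abs_le.1 hph).1 (abs_le.1 hph).2
      have := Real.one_sub_sq_div_two_le_cos (x := a * t + b * x)
      linarith

lemma sum_range_inv_le_two_mul_sqrt (K : ℕ) :
    ∑ k ∈ Finset.range (K + 1), (k : ℝ)⁻¹ ≤ 2 * √K := by
  induction K with
  | zero => simp
  | succ K ih =>
    rw [Finset.sum_range_succ]
    have h1 : √(K : ℝ) ^ 2 = K := Real.sq_sqrt (by positivity)
    have h2 : √((K + 1 : ℕ) : ℝ) ^ 2 = K + 1 := by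
      rw [Real.sq_sqrt (by positivity)]; push_cast; rfl
    have h3 : 0 < √((K + 1 : ℕ) : ℝ) := Real.sqrt_pos.2 (by positivity)
    have h4 : √(K : ℝ) ≤ √((K + 1 : ℕ) : ℝ) := Real.sqrt_le_sqrt (by push_cast; linarith)
    have h6 : (((K + 1 : ℕ) : ℝ))⁻¹ ≤ 2 * (√((K + 1 : ℕ) : ℝ) - √(K : ℝ)) := by
      rw [inv_le_iff_one_le_mul₀ (by positivity)]
      have : ((K + 1 : ℕ) : ℝ) = √((K + 1 : ℕ) : ℝ) ^ 2 := by rw [h2]; push_cast; rfl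
      rw [this, Real.sqrt_sq h3.le]
      have h7 : 1 ≤ √((K + 1 : ℕ) : ℝ) := by
        rw [Real.one_le_sqrt]; push_cast; linarith [Nat.cast_nonneg (α := ℝ) K]
      have h8 : (√((K + 1 : ℕ) : ℝ) - √K) * (√((K + 1 : ℕ) : ℝ) + √K) = 1 := by
        linear_combination h2 - h1
      nlinarith [Real.sqrt_nonneg (K : ℝ)]
    linarith

lemma sum_Icc_inv_abs_sub_le (N : ℕ) {n : ℤ} (hn : n ∈ Finset.Icc (-(N : ℤ)) N) :
    ∑ m ∈ Finset.Icc (-(N : ℤ)) N, |((n - m : ℤ) : ℝ)|⁻¹ ≤ 4 * √((2 * N : ℕ) : ℝ) := by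
  rw [Finset.mem_Icc] at hn
  calc ∑ m ∈ Finset.Icc (-(N : ℤ)) N, |((n - m : ℤ) : ℝ)|⁻¹
      = ∑ j ∈ (Finset.Icc (-(N : ℤ)) N).image (fun m => n - m), |(j : ℝ)|⁻¹ := by
        rw [Finset.sum_image]
        intro a _ b _ h
        simpa using h
    _ ≤ ∑ j ∈ Finset.Icc (-((2 * N : ℕ) : ℤ)) (2 * N : ℕ), |(j : ℝ)|⁻¹ := by
        refine Finset.sum_le_sum_of_subset_of_nonneg ?_ fun _ _ _ => by positivity
        intro j hj
        simp only [Finset.mem_image, Finset.mem_Icc] at hj ⊢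
        obtain ⟨m, hm, rfl⟩ := hj
        push_cast
        omega
    _ = 2 * ∑ k ∈ Finset.range (2 * N + 1), (k : ℝ)⁻¹ := by
        rw [Finset.sum_Icc_of_even_eq_range (f := fun j : ℤ => |(j : ℝ)|⁻¹) (by intro j; simp)]
        simp
    _ ≤ 4 * √((2 * N : ℕ) : ℝ) := by linarith [sum_range_inv_le_two_mul_sqrt (2 * N)]

/-- Fubini for the pairing of `Ef` with a test function on a box. -/
lemma setIntegral_extOp_mul_conj {f : ℝ → ℝ} (hf : Continuous f) {G : ℝ × ℝ → ℂ}
    (hG : Continuous G) (X T : ℝ) :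
    ∫ z in box X T, extOp (fun ω => (f ω : ℂ)) z * (starRingEnd ℂ) (G z) =
      ∫ ω in Icc (-1 : ℝ) 1,
        (f ω : ℂ) * ∫ z in box X T, planeWave ω z * (starRingEnd ℂ) (G z) := by
  have hc : Continuous (Function.uncurry fun (z : ℝ × ℝ) (ω : ℝ) =>
      (f ω : ℂ) * (planeWave ω z * (starRingEnd ℂ) (G z))) := by
    have := continuous_planeWave.comp (continuous_swap (X := ℝ × ℝ) (Y := ℝ))
    simp only [Function.uncurry_def, Function.comp_def, Prod.fst_swap, Prod.snd_swap] at this ⊢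
    have h2 : Continuous (fun z => (starRingEnd ℂ) (G z)) := Complex.continuous_conj.comp hG
    fun_prop
  have hint : Integrable (Function.uncurry fun (z : ℝ × ℝ) (ω : ℝ) =>
      (f ω : ℂ) * (planeWave ω z * (starRingEnd ℂ) (G z)))
      ((volume.restrict (box X T)).prod (volume.restrict (Icc (-1 : ℝ) 1))) := by
    rw [Measure.prod_restrict]
    exact hc.continuousOn.integrableOn_compact ((isCompact_box X T).prod isCompact_Icc)
  calc _ = ∫ z in box X T, ∫ ω in Icc (-1 : ℝ) 1,
        (f ω : ℂ) * (planeWave ω z * (starRingEnd ℂ) (G z)) := by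
        congr 1 with z
        rw [extOp, ← integral_mul_const]
        congr 1 with ω
        simp only [planeWave]
        ring
    _ = ∫ ω in Icc (-1 : ℝ) 1, ∫ z in box X T,
        (f ω : ℂ) * (planeWave ω z * (starRingEnd ℂ) (G z)) := integral_integral_swap hint
    _ = _ := by simp_rw [integral_const_mul]

lemma continuous_extOp {f : ℝ → ℂ} (hf : Continuous f) : Continuous (extOp f) := by
  unfold extOp
  exact continuous_parametric_integral_of_continuous
    (f := fun (z : ℝ × ℝ) (ω : ℝ) =>
      Complex.exp (Complex.I * ((ω ^ 2 * z.2 + ω * z.1 : ℝ) : ℂ)) * f ω)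
    (by simp only [Function.uncurry_def]; fun_prop) isCompact_Icc

lemma le_re_setIntegral_extOp_mul_conj {f : ℝ → ℝ} (hf : Continuous f) (hf0 : ∀ ω, 0 ≤ f ω)
    {G : ℝ × ℝ → ℂ} (hG : Continuous G) (X T κ : ℝ)
    (hK : ∀ ω, f ω ≠ 0 →
      κ ≤ (∫ z in box X T, planeWave ω z * (starRingEnd ℂ) (G z)).re) :
    κ * ∫ ω in Icc (-1 : ℝ) 1, f ω ≤
      (∫ z in box X T, extOp (fun ω => (f ω : ℂ)) z * (starRingEnd ℂ) (G z)).re := by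
  rw [setIntegral_extOp_mul_conj hf hG]
  have hKc : Continuous fun ω => ∫ z in box X T, planeWave ω z * (starRingEnd ℂ) (G z) := by
    refine continuous_parametric_integral_of_continuous
      (f := fun (ω : ℝ) (z : ℝ × ℝ) => planeWave ω z * (starRingEnd ℂ) (G z)) ?_
      (isCompact_box X T)
    have h1 := continuous_planeWave
    have h2 : Continuous (fun z => (starRingEnd ℂ) (G z)) := Complex.continuous_conj.comp hG
    simp only [Function.uncurry_def]
    fun_prop
  have hint : IntegrableOn (fun ω => (f ω : ℂ) *
      ∫ z in box X T, planeWave ω z * (starRingEnd ℂ) (G z)) (Icc (-1 : ℝ) 1) :=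
    (by fun_prop : Continuous _).continuousOn.integrableOn_compact isCompact_Icc
  have hre := integral_re (𝕜 := ℂ) hint
  simp only [RCLike.re_to_complex] at hre
  rw [← hre, ← integral_const_mul]
  refine setIntegral_mono_on
    ((by fun_prop : Continuous _).continuousOn.integrableOn_compact isCompact_Icc) hint.re
    measurableSet_Icc fun ω _ => ?_
  simp only [Complex.re_ofReal_mul]
  by_cases h : f ω = 0
  · simp [h]
  · rw [mul_comm]
    exact mul_le_mul_of_nonneg_left (hK ω h) (hf0 ω)

lemma box_subset_ball {X T R : ℝ} (hX : X < R) (hT : T < R) :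
    box X T ⊆ Metric.ball (0 : ℝ × ℝ) R := by
  rintro ⟨x, t⟩ ⟨⟨hx0, hx1⟩, ht0, ht1⟩
  dsimp at hx0 hx1 ht0 ht1
  rw [mem_ball_zero_iff, Prod.norm_def, max_lt_iff, Real.norm_eq_abs, Real.norm_eq_abs,
    abs_of_nonneg hx0, abs_of_nonneg ht0]
  exact ⟨by linarith, by linarith⟩

lemma eLpNorm_two_restrict_box_le {G : ℝ × ℝ → ℂ} (hG : Continuous G) (X T : ℝ) {B : ℝ}
    (hB : ∫ z in box X T, ‖G z‖ ^ 2 ≤ B) :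
    eLpNorm G 2 (volume.restrict (box X T)) ≤ ENNReal.ofReal √B := by
  have hmem : MemLp G 2 (volume.restrict (box X T)) := by
    rw [memLp_two_iff_integrable_sq_norm hG.aestronglyMeasurable]
    exact (by fun_prop : Continuous _).continuousOn.integrableOn_compact (isCompact_box X T)
  rw [hmem.eLpNorm_eq_integral_rpow_norm two_ne_zero ENNReal.ofNat_ne_top]
  apply ENNReal.ofReal_le_ofReal
  rw [Real.sqrt_eq_rpow]
  simp only [ENNReal.toReal_ofNat, Real.rpow_two, one_div]
  gcongr

lemma enorm_setIntegral_mul_conj_le {F G : ℝ × ℝ → ℂ} (hF : Continuous F) (hG : Continuous G)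
    (S : Set (ℝ × ℝ)) :
    ‖∫ z in S, F z * (starRingEnd ℂ) (G z)‖ₑ ≤
      eLpNorm F 2 (volume.restrict S) * eLpNorm G 2 (volume.restrict S) := by
  have hGc : Continuous (fun z => (starRingEnd ℂ) (G z)) := Complex.continuous_conj.comp hG
  have hGn : eLpNorm (fun z => (starRingEnd ℂ) (G z)) 2 (volume.restrict S) =
      eLpNorm G 2 (volume.restrict S) :=
    eLpNorm_congr_norm_ae (Filter.Eventually.of_forall fun z => RCLike.norm_conj _)
  refine (enorm_integral_le_lintegral_enorm _).trans ?_
  rw [← eLpNorm_one_eq_lintegral_enorm, ← hGn]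
  have h := eLpNorm_smul_le_mul_eLpNorm (p := 2) (q := 2) (r := 1) (μ := volume.restrict S)
    (f := fun z => (starRingEnd ℂ) (G z)) (φ := F)
    hGc.aestronglyMeasurable hF.aestronglyMeasurable
  exact h

/-- Duality: a test function correlating with every plane wave in the frequency support of
`f ≥ 0` bounds `‖Ef‖_{Lᵖ}` from below. -/
lemma le_LpBall_extOp {f : ℝ → ℝ} (hf : Continuous f) (hf0 : ∀ ω, 0 ≤ f ω)
    {G : ℝ × ℝ → ℂ} (hG : Continuous G) {X T R p B κ I : ℝ} (hX : 0 < X) (hT : 0 < T)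
    (hXR : X < R) (hTR : T < R) (hp : 2 ≤ p) (hB0 : 0 < B) (hκ : 0 ≤ κ)
    (hB : ∫ z in box X T, ‖G z‖ ^ 2 ≤ B * (X * T))
    (hK : ∀ ω, f ω ≠ 0 →
      κ * (X * T) ≤ (∫ z in box X T, planeWave ω z * (starRingEnd ℂ) (G z)).re)
    (hI : I ≤ ∫ ω in Icc (-1 : ℝ) 1, f ω) :
    ENNReal.ofReal (κ * I * (X * T) ^ (1 / p) / √B) ≤
      LpBall (extOp fun ω => (f ω : ℂ)) p R := by
  set F := extOp fun ω => (f ω : ℂ) with hFdef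
  have hF : Continuous F := continuous_extOp (by fun_prop)
  set V := X * T with hV
  have hV0 : 0 < V := mul_pos hX hT
  by_cases htop : LpBall F p R = ⊤
  · rw [htop]; exact le_top
  have hlow := le_re_setIntegral_extOp_mul_conj hf hf0 hG X T (κ * V) hK
  have hlow' : κ * V * I ≤ ‖∫ z in box X T, F z * (starRingEnd ℂ) (G z)‖ :=
    ((mul_le_mul_of_nonneg_left hI (by positivity)).trans hlow).trans (Complex.re_le_norm _)
  have h2p : eLpNorm F 2 (volume.restrict (box X T)) ≤
      LpBall F p R * ENNReal.ofReal (V ^ (1 / 2 - 1 / p)) := by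
    refine (eLpNorm_le_eLpNorm_mul_rpow_measure_univ (q := ENNReal.ofReal p) ?_
      hF.aestronglyMeasurable).trans ?_
    · rw [← ENNReal.ofReal_ofNat]
      exact ENNReal.ofReal_le_ofReal hp
    · refine mul_le_mul' ?_ (le_of_eq ?_)
      · exact eLpNorm_mono_measure _ (Measure.restrict_mono (box_subset_ball hXR hTR) le_rfl)
      · rw [Measure.restrict_apply_univ, volume_box hX.le, ENNReal.toReal_ofReal (by linarith),
          ENNReal.toReal_ofNat, ENNReal.ofReal_rpow_of_pos hV0]
  have hchain : ENNReal.ofReal (κ * V * I) ≤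
      LpBall F p R * ENNReal.ofReal (V ^ (1 / 2 - 1 / p)) * ENNReal.ofReal √(B * V) := by
    refine (ENNReal.ofReal_le_ofReal hlow').trans ?_
    rw [ofReal_norm]
    exact (enorm_setIntegral_mul_conj_le hF hG _).trans
      (mul_le_mul' h2p (eLpNorm_two_restrict_box_le hG X T hB))
  obtain ⟨L, hL0, hL⟩ : ∃ L : ℝ, 0 ≤ L ∧ LpBall F p R = ENNReal.ofReal L :=
    ⟨_, ENNReal.toReal_nonneg, (ENNReal.ofReal_toReal htop).symm⟩
  rw [hL] at hchain ⊢
  rw [← ENNReal.ofReal_mul hL0, ← ENNReal.ofReal_mul (by positivity),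
    ENNReal.ofReal_le_ofReal_iff (by positivity)] at hchain
  apply ENNReal.ofReal_le_ofReal
  have hsB : 0 < √B := Real.sqrt_pos.2 hB0
  rw [div_le_iff₀ hsB]
  have hVsplit : V ^ (1 / 2 - 1 / p) * √V * V ^ (1 / p) = V := by
    rw [Real.sqrt_eq_rpow, ← Real.rpow_add hV0, ← Real.rpow_add hV0]
    ring_nf
    exact Real.rpow_one V
  rw [Real.sqrt_mul hB0.le] at hchain
  have hq : 0 < V ^ (1 / 2 - 1 / p) * √V := by positivity
  refine le_of_mul_le_mul_right ?_ hq
  calc κ * I * V ^ (1 / p) * (V ^ (1 / 2 - 1 / p) * √V)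
      = κ * I * (V ^ (1 / 2 - 1 / p) * √V * V ^ (1 / p)) := by ring
    _ = κ * V * I := by rw [hVsplit]; ring
    _ ≤ _ := hchain
    _ = L * √B * (V ^ (1 / 2 - 1 / p) * √V) := by ring

/-- The exponential sum with frequencies `nδ`, `|n| ≤ N`. -/
def latticeSum (δ : ℝ) (N : ℕ) (z : ℝ × ℝ) : ℂ :=
  ∑ m ∈ Finset.Icc (-(N : ℤ)) N, planeWave (m * δ) z

lemma continuous_latticeSum (δ : ℝ) (N : ℕ) : Continuous (latticeSum δ N) := by
  unfold latticeSum
  fun_prop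

lemma integrableOn_planeWave_mul_conj (ω η X T : ℝ) :
    IntegrableOn (fun z => planeWave ω z * (starRingEnd ℂ) (planeWave η z)) (box X T) := by
  refine (Continuous.continuousOn ?_).integrableOn_compact (isCompact_box X T)
  exact (continuous_planeWave_right ω).mul
    (Complex.continuous_conj.comp (continuous_planeWave_right η))

lemma setIntegral_planeWave_mul_conj_latticeSum (ω δ X T : ℝ) (N : ℕ) :
    ∫ z in box X T, planeWave ω z * (starRingEnd ℂ) (latticeSum δ N z) =
      ∑ m ∈ Finset.Icc (-(N : ℤ)) N,
        ∫ z in box X T, planeWave ω z * (starRingEnd ℂ) (planeWave (m * δ) z) := by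
  simp only [latticeSum, map_sum, Finset.mul_sum]
  exact integral_finsetSum _ fun m _ => integrableOn_planeWave_mul_conj _ _ _ _

/-- Almost orthogonality: only the nearest lattice frequency contributes to the pairing of a
plane wave with the lattice sum. -/
lemma norm_setIntegral_planeWave_sub_le {δ ω X T : ℝ} {N : ℕ} {n : ℤ} (hδ : 0 < δ) (hX : 0 ≤ X)
    (hT : 0 ≤ T) (hN : 2 ≤ N) (hn : n ∈ Finset.Icc (-(N : ℤ)) N) (hω : |ω - n * δ| ≤ δ / N) :
    ‖(∫ z in box X T, planeWave ω z * (starRingEnd ℂ) (latticeSum δ N z)) -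
        ∫ z in box X T, planeWave ω z * (starRingEnd ℂ) (planeWave (n * δ) z)‖ ≤
      16 * √((2 * N : ℕ) : ℝ) * T / δ := by
  rw [setIntegral_planeWave_mul_conj_latticeSum, ← Finset.add_sum_erase _ _ hn,
    add_sub_cancel_left]
  have hN' : (2 : ℝ) ≤ N := by exact_mod_cast hN
  have hhalf : |ω - n * δ| ≤ δ / 2 := hω.trans (by gcongr)
  calc _ ≤ ∑ m ∈ (Finset.Icc (-(N : ℤ)) N).erase n, 4 * T / δ * |((n - m : ℤ) : ℝ)|⁻¹ := by
        refine norm_sum_le_of_le _ fun m hm => ?_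
        have hnm : (1 : ℝ) ≤ |((n - m : ℤ) : ℝ)| := by
          rw [← Int.cast_abs]
          exact_mod_cast Int.one_le_abs (sub_ne_zero.2 (Finset.ne_of_mem_erase hm).symm)
        have hfreq : |((n - m : ℤ) : ℝ)| * δ / 2 ≤ |ω - m * δ| := by
          have htri : |((n - m : ℤ) : ℝ) * δ| ≤ |ω - m * δ| + |ω - n * δ| := by
            have : ((n - m : ℤ) : ℝ) * δ = (ω - m * δ) - (ω - n * δ) := by push_cast; ring
            rw [this]
            exact abs_sub _ _
          rw [abs_mul, abs_of_pos hδ] at htri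
          nlinarith
        have hpos : 0 < |((n - m : ℤ) : ℝ)| * δ / 2 := by positivity
        simp_rw [planeWave_mul_conj]
        refine (norm_setIntegral_box_exp_le hX hT _
          (abs_pos.1 (hpos.trans_le hfreq))).trans ?_
        calc 2 / |ω - m * δ| * T ≤ 2 / (|((n - m : ℤ) : ℝ)| * δ / 2) * T := by gcongr
          _ = _ := by field_simp; ring
    _ ≤ ∑ m ∈ Finset.Icc (-(N : ℤ)) N, 4 * T / δ * |((n - m : ℤ) : ℝ)|⁻¹ :=
        Finset.sum_le_sum_of_subset_of_nonneg (Finset.erase_subset _ _)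
          fun _ _ _ => by positivity
    _ ≤ 4 * T / δ * (4 * √((2 * N : ℕ) : ℝ)) := by
        rw [← Finset.mul_sum]
        gcongr
        exact sum_Icc_inv_abs_sub_le N hn
    _ = _ := by ring

lemma off_diagonal_le_area {δ T : ℝ} {N : ℕ} (hδ : 0 < δ) (hT : 0 ≤ T) (hN : 10 ^ 6 ≤ N) :
    16 * √((2 * N : ℕ) : ℝ) * T / δ ≤ 1 / 4 * (N / (8 * δ) * T) := by
  have hN' : (10 : ℝ) ^ 6 ≤ N := by exact_mod_cast hN
  have hs : 512 * √((2 * N : ℕ) : ℝ) ≤ N := by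
    rw [← le_div_iff₀' (by norm_num), Real.sqrt_le_iff]
    refine ⟨by positivity, ?_⟩
    push_cast
    nlinarith
  calc 16 * √((2 * N : ℕ) : ℝ) * T / δ = 512 * √((2 * N : ℕ) : ℝ) * (T / δ) / 32 := by ring
    _ ≤ N * (T / δ) / 32 := by gcongr
    _ = _ := by field_simp; ring

lemma le_re_setIntegral_planeWave_mul_conj_latticeSum {δ ω : ℝ} {N : ℕ} {n : ℤ} (hδ : 0 < δ)
    (hN : 10 ^ 6 ≤ N) (hn : n ∈ Finset.Icc (-(N : ℤ)) N) (hω : |ω - n * δ| ≤ δ / N) :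
    1 / 2 * (N / (8 * δ) * (1 / (8 * δ ^ 2))) ≤
      (∫ z in box (N / (8 * δ)) (1 / (8 * δ ^ 2)),
        planeWave ω z * (starRingEnd ℂ) (latticeSum δ N z)).re := by
  have hT : (0 : ℝ) ≤ 1 / (8 * δ ^ 2) := by positivity
  have hX : (0 : ℝ) ≤ N / (8 * δ) := by positivity
  have hN0 : (0 : ℝ) < N := by
    have : (10 : ℝ) ^ 6 ≤ N := by exact_mod_cast hN
    linarith
  have hN1 : (1 : ℝ) ≤ N := by
    have : (10 : ℝ) ^ 6 ≤ N := by exact_mod_cast hN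
    linarith
  have hoff := (norm_setIntegral_planeWave_sub_le hδ hX hT (by lia) hn hω).trans
    (off_diagonal_le_area hδ hT hN)
  have hdiag : 3 / 4 * (N / (8 * δ) * (1 / (8 * δ ^ 2))) ≤
      (∫ z in box (N / (8 * δ)) (1 / (8 * δ ^ 2)),
        planeWave ω z * (starRingEnd ℂ) (planeWave (n * δ) z)).re := by
    simp_rw [planeWave_mul_conj]
    refine le_re_setIntegral_box_exp hX hT ?_
    have hnN : |(n : ℝ)| ≤ N := by
      rw [Finset.mem_Icc] at hn
      rw [← Int.cast_abs]
      exact_mod_cast abs_le.2 hn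
    have hsum : |ω + n * δ| ≤ 3 * N * δ := by
      have h1 : ω + n * δ = (ω - n * δ) + 2 * (n * δ) := by ring
      have h2 : δ / N ≤ N * δ := by
        rw [div_le_iff₀ hN0]
        nlinarith [mul_le_mul hN1 hN1 zero_le_one hN0.le]
      rw [h1]
      refine (abs_add_le _ _).trans ?_
      rw [abs_mul, abs_mul, abs_of_pos hδ, abs_two]
      nlinarith
    have hq : |ω ^ 2 - (n * δ) ^ 2| ≤ 3 * δ ^ 2 := by
      calc |ω ^ 2 - (n * δ) ^ 2| = |ω - n * δ| * |ω + n * δ| := by rw [← abs_mul]; ring_nf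
        _ ≤ δ / N * (3 * N * δ) := by gcongr
        _ = 3 * δ ^ 2 := by field_simp
    calc _ ≤ 3 * δ ^ 2 * (1 / (8 * δ ^ 2)) + δ / N * (N / (8 * δ)) := by gcongr
      _ = 1 / 2 := by field_simp; norm_num
  have := (Complex.abs_re_le_norm _).trans hoff
  rw [Complex.sub_re] at this
  linarith [(abs_le.1 this).1]

lemma setIntegral_norm_latticeSum_sq_le {δ : ℝ} {N : ℕ} (hδ : 0 < δ) (hN : 10 ^ 6 ≤ N) :
    ∫ z in box (N / (8 * δ)) (1 / (8 * δ ^ 2)), ‖latticeSum δ N z‖ ^ 2 ≤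
      4 * N * (N / (8 * δ) * (1 / (8 * δ ^ 2))) := by
  set X : ℝ := N / (8 * δ) with hXdef
  set T : ℝ := 1 / (8 * δ ^ 2) with hTdef
  have hT : 0 ≤ T := by positivity
  have hX : 0 ≤ X := by positivity
  have hN0 : (1 : ℝ) ≤ N := by exact_mod_cast (by lia : 1 ≤ N)
  have hG := continuous_latticeSum δ N
  have hGc : Continuous (fun z => (starRingEnd ℂ) (latticeSum δ N z)) :=
    Complex.continuous_conj.comp hG
  have hexp : ((∫ z in box X T, ‖latticeSum δ N z‖ ^ 2 : ℝ) : ℂ) =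
      ∑ n ∈ Finset.Icc (-(N : ℤ)) N,
        ∫ z in box X T, planeWave (n * δ) z * (starRingEnd ℂ) (latticeSum δ N z) := by
    rw [← integral_complex_ofReal, ← integral_finsetSum]
    · congr 1 with z
      rw [← Finset.sum_mul, ← latticeSum, Complex.mul_conj']
      simp
    · exact fun n _ => ((continuous_planeWave_right _).mul hGc).continuousOn.integrableOn_compact
        (isCompact_box X T)
  have hterm : ∀ n ∈ Finset.Icc (-(N : ℤ)) N,
      ‖∫ z in box X T, planeWave (n * δ) z * (starRingEnd ℂ) (latticeSum δ N z)‖ ≤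
        5 / 4 * (X * T) := by
    intro n hn
    have hoff := (norm_setIntegral_planeWave_sub_le (ω := n * δ) hδ hX hT (by lia) hn
      (by rw [sub_self, abs_zero]; positivity)).trans (off_diagonal_le_area hδ hT hN)
    have hdiag : ‖∫ z in box X T,
        planeWave (n * δ) z * (starRingEnd ℂ) (planeWave (n * δ) z)‖ ≤ X * T := by
      simp_rw [planeWave_mul_conj]
      exact norm_setIntegral_box_exp_le_area hX hT _ _
    have := norm_le_norm_add_norm_sub' (∫ z in box X T,
      planeWave (n * δ) z * (starRingEnd ℂ) (latticeSum δ N z)) (∫ z in box X T,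
        planeWave (n * δ) z * (starRingEnd ℂ) (planeWave (n * δ) z))
    linarith
  have hsum := norm_sum_le_of_le _ hterm
  rw [← hexp, Finset.sum_const, nsmul_eq_mul, Int.card_Icc,
    show ((N : ℤ) + 1 - -(N : ℤ)).toNat = 2 * N + 1 by lia] at hsum
  refine (le_trans (le_abs_self _) ?_).trans (hsum.trans ?_)
  · rw [Complex.norm_real, Real.norm_eq_abs]
  · push_cast
    have : 0 ≤ X * T := mul_nonneg hX hT
    nlinarith

/-- The real-valued version of `bundleFn`. -/
def bundleReal (δ : ℝ) (N : ℕ) (Θ : ℝ → ℝ) (ω : ℝ) : ℝ :=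
  ∑ n ∈ Finset.Icc (-(N : ℤ)) (N : ℤ), Θ (ω - n * δ)

lemma continuous_bundleReal (δ : ℝ) (N : ℕ) {Θ : ℝ → ℝ} (hΘ : Continuous Θ) :
    Continuous (bundleReal δ N Θ) := by
  unfold bundleReal
  fun_prop

lemma exists_abs_sub_le_of_bundleReal_ne_zero {δ : ℝ} {N : ℕ} {Θ : ℝ → ℝ}
    (hsupp : Function.support Θ ⊆ Icc (-(δ / N)) (δ / N)) {ω : ℝ}
    (hω : bundleReal δ N Θ ω ≠ 0) :
    ∃ n ∈ Finset.Icc (-(N : ℤ)) N, |ω - n * δ| ≤ δ / N := by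
  obtain ⟨n, hn, hne⟩ := Finset.exists_ne_zero_of_sum_ne_zero hω
  exact ⟨n, hn, abs_le.2 (hsupp hne)⟩

/-- The bundle function has mass at least `δ` on `[-1, 1]`. -/
lemma le_integral_bundleReal {δ : ℝ} {N : ℕ} {Θ : ℝ → ℝ} (hδ : 0 < δ) (hN : 0 < N)
    (hNδ : N * δ ≤ 1) (hΘ : Continuous Θ) (hΘ0 : ∀ ω, 0 ≤ Θ ω)
    (hone : ∀ ω, |ω| ≤ δ / (2 * N) → Θ ω = 1) :
    δ ≤ ∫ ω in Icc (-1 : ℝ) 1, bundleReal δ N Θ ω := by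
  have hN1 : (1 : ℝ) ≤ N := by exact_mod_cast hN
  have hint : ∀ (n : ℤ) (a b : ℝ), IntegrableOn (fun ω => Θ (ω - n * δ)) (Icc a b) := fun n a b =>
    (by fun_prop : Continuous _).continuousOn.integrableOn_compact isCompact_Icc
  have hterm : ∀ n ∈ Finset.Icc (-((N - 1 : ℕ) : ℤ)) (N - 1 : ℕ),
      δ / N ≤ ∫ ω in Icc (-1 : ℝ) 1, Θ (ω - n * δ) := by
    intro n hn
    have hnN : |(n : ℝ)| ≤ N - 1 := by
      rw [Finset.mem_Icc] at hn
      have : |n| ≤ (N : ℤ) - 1 := abs_le.2 (by lia)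
      rw [← Int.cast_abs]
      exact_mod_cast this
    have hnδ : |n * δ| ≤ 1 - δ := by
      rw [abs_mul, abs_of_pos hδ]
      nlinarith
    have hw : δ / (2 * N) ≤ δ := div_le_self hδ.le (by linarith)
    obtain ⟨h1, h2⟩ := abs_le.1 hnδ
    calc δ / N = ∫ ω in Icc (n * δ - δ / (2 * N)) (n * δ + δ / (2 * N)), (1 : ℝ) := by
          rw [setIntegral_const, Real.volume_real_Icc_of_le (by
            have : 0 ≤ δ / (2 * N) := by positivity
            linarith), smul_eq_mul]
          field_simp
          ring
      _ = ∫ ω in Icc (n * δ - δ / (2 * N)) (n * δ + δ / (2 * N)), Θ (ω - n * δ) := by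
          refine setIntegral_congr_fun measurableSet_Icc fun ω hω => ?_
          exact (hone _ (abs_le.2 ⟨by linarith [hω.1], by linarith [hω.2]⟩)).symm
      _ ≤ _ := by
          refine setIntegral_mono_set (hint n _ _)
            (Filter.Eventually.of_forall fun ω => hΘ0 _) ?_
          exact (Icc_subset_Icc (by linarith) (by linarith)).eventuallyLE
  unfold bundleReal
  rw [integral_finsetSum _ fun n _ => hint n _ _]
  calc δ ≤ ∑ _n ∈ Finset.Icc (-((N - 1 : ℕ) : ℤ)) (N - 1 : ℕ), δ / N := by
        rw [Finset.sum_const, nsmul_eq_mul, Int.card_Icc,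
          show (((N - 1 : ℕ) : ℤ) + 1 - -((N - 1 : ℕ) : ℤ)).toNat = 2 * (N - 1) + 1 by lia]
        have hcast : ((2 * (N - 1) + 1 : ℕ) : ℝ) = 2 * N - 1 := by
          push_cast [Nat.cast_sub (Nat.succ_le_of_lt hN)]
          ring
        rw [hcast, mul_div_assoc', le_div_iff₀ (by linarith)]
        nlinarith
    _ ≤ ∑ n ∈ Finset.Icc (-((N - 1 : ℕ) : ℤ)) (N - 1 : ℕ),
          ∫ ω in Icc (-1 : ℝ) 1, Θ (ω - n * δ) := Finset.sum_le_sum hterm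
    _ ≤ _ := Finset.sum_le_sum_of_subset_of_nonneg
        (Finset.Icc_subset_Icc (by lia) (by lia))
        fun n _ _ => integral_nonneg fun ω => hΘ0 _

/-- For few frequencies the constant function on a small box correlates with all of them. -/
lemma le_re_setIntegral_planeWave {δ ω : ℝ} {N : ℕ} {n : ℤ} (hδ : 0 < δ) (hN0 : 0 < N)
    (hN : N < 10 ^ 6) (hn : n ∈ Finset.Icc (-(N : ℤ)) N) (hω : |ω - n * δ| ≤ δ / N) :
    1 / 2 * (1 / (10 ^ 13 * δ) * (1 / (10 ^ 13 * δ ^ 2))) ≤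
      (∫ z in box (1 / (10 ^ 13 * δ)) (1 / (10 ^ 13 * δ ^ 2)),
        planeWave ω z * (starRingEnd ℂ) 1).re := by
  have hN1 : (1 : ℝ) ≤ N := by exact_mod_cast hN0
  have hN' : (N : ℝ) ≤ 10 ^ 6 := by exact_mod_cast hN.le
  have hω' : |ω| ≤ 2 * 10 ^ 6 * δ := by
    have hnN : |(n : ℝ)| ≤ N := by
      rw [Finset.mem_Icc] at hn
      rw [← Int.cast_abs]
      exact_mod_cast abs_le.2 hn
    have h1 : ω = (ω - n * δ) + n * δ := by ring
    rw [h1]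
    refine (abs_add_le _ _).trans ?_
    rw [abs_mul, abs_of_pos hδ]
    have h2 : δ / N ≤ δ := div_le_self hδ.le hN1
    nlinarith
  have h := le_re_setIntegral_box_exp (X := 1 / (10 ^ 13 * δ)) (T := 1 / (10 ^ 13 * δ ^ 2))
    (a := ω ^ 2) (b := ω) (by positivity) (by positivity) (by
      rw [abs_pow]
      calc _ ≤ (2 * 10 ^ 6 * δ) ^ 2 * (1 / (10 ^ 13 * δ ^ 2)) +
            2 * 10 ^ 6 * δ * (1 / (10 ^ 13 * δ)) := by gcongr
        _ ≤ 1 / 2 := by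
          field_simp
          norm_num)
  simp only [map_one, mul_one]
  exact le_trans (mul_le_mul_of_nonneg_right (by norm_num) (by positivity)) h

lemma exists_test_function :
    ∃ a : ℝ, 0 < a ∧ ∀ (δ : ℝ) (N : ℕ), 0 < δ → δ ≤ 1 → 0 < N → N * δ < 1 →
      ∃ (X T : ℝ) (G : ℝ × ℝ → ℂ), 0 < X ∧ 0 < T ∧ X < 1 / δ ^ 2 ∧ T < 1 / δ ^ 2 ∧
        Continuous G ∧ a * N / δ ^ 3 ≤ X * T ∧
        ∫ z in box X T, ‖G z‖ ^ 2 ≤ 4 * N * (X * T) ∧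
        ∀ (ω : ℝ), ∀ n ∈ Finset.Icc (-(N : ℤ)) N, |ω - n * δ| ≤ δ / N →
          1 / 2 * (X * T) ≤ (∫ z in box X T, planeWave ω z * (starRingEnd ℂ) (G z)).re := by
  refine ⟨1 / 10 ^ 32, by norm_num, fun δ N hδ hδ1 hN hNδ => ?_⟩
  have hN1 : (1 : ℝ) ≤ N := by exact_mod_cast hN
  rcases lt_or_ge N (10 ^ 6) with hsmall | hlarge
  · have hN' : (N : ℝ) ≤ 10 ^ 6 := by exact_mod_cast hsmall.le
    refine ⟨1 / (10 ^ 13 * δ), 1 / (10 ^ 13 * δ ^ 2), fun _ => 1, by positivity, by positivity,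
      ?_, ?_, continuous_const, ?_, ?_,
      fun ω n hn hω => le_re_setIntegral_planeWave hδ hN hsmall hn hω⟩
    · rw [div_lt_div_iff₀ (by positivity) (by positivity)]
      nlinarith
    · rw [div_lt_div_iff₀ (by positivity) (by positivity)]
      nlinarith [pow_pos hδ 2]
    · calc 1 / 10 ^ 32 * N / δ ^ 3 ≤ 1 / 10 ^ 32 * 10 ^ 6 / δ ^ 3 := by gcongr
        _ = _ := by field_simp
    · simp only [norm_one, one_pow]
      rw [setIntegral_const, volume_real_box (by positivity) (by positivity),
        smul_eq_mul, mul_one]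
      exact le_mul_of_one_le_left (by positivity) (by linarith)
  · refine ⟨N / (8 * δ), 1 / (8 * δ ^ 2), latticeSum δ N, by positivity, by positivity,
      ?_, ?_, continuous_latticeSum δ N, ?_, setIntegral_norm_latticeSum_sq_le hδ hlarge,
      fun ω n hn hω => le_re_setIntegral_planeWave_mul_conj_latticeSum hδ hlarge hn hω⟩
    · rw [div_lt_div_iff₀ (by positivity) (by positivity)]
      nlinarith
    · rw [div_lt_div_iff₀ (by positivity) (by positivity)]
      nlinarith [pow_pos hδ 2]
    · calc 1 / 10 ^ 32 * N / δ ^ 3 ≤ 1 / 64 * N / δ ^ 3 := by gcongr; norm_num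
        _ = _ := by field_simp; norm_num

/-- **Lower bound for the bundle scenario** (equation (6.5) of the paper): for every
`p ∈ [2,6]` and `ε > 0` there is `c(ε,p) > 0` such that for all sufficiently large
`R` and any positive integer `N < R^{1/2}`,
`‖Ef_{R,N}‖_{L^p(B_R)} ≥ c(ε,p) · R^{3/(2p) - 1/2 - ε} · N^{1/p - 1/2}`. -/
theorem bundle_lower_bound (p ε : ℝ) (hp2 : 2 ≤ p) (hp6 : p ≤ 6) (hε : 0 < ε) :
    ∃ c : ℝ, 0 < c ∧ ∃ R₀ : ℝ, ∀ R : ℝ, R₀ ≤ R → ∀ N : ℕ, 0 < N →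
      (N : ℝ) < R ^ ((1 : ℝ) / 2) → ∀ Θ : ℝ → ℝ, IsBundleBump R N Θ →
      ENNReal.ofReal (c * R ^ (3 / (2 * p) - 1 / 2 - ε) * (N : ℝ) ^ (1 / p - 1 / 2)) ≤
        LpBall (extOp (bundleFn R N Θ)) p R := by
  obtain ⟨a, ha, htest⟩ := exists_test_function
  refine ⟨a ^ (1 / p) / 4, by positivity, 1, fun R hR N hN hNR Θ hΘ => ?_⟩
  obtain ⟨hsmooth, hbd, hone, hsupp⟩ := hΘ
  have hR0 : 0 < R := by linarith
  have hN0 : (0 : ℝ) < N := by exact_mod_cast hN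
  have hfun : bundleFn R N Θ = fun ω => ((bundleReal (R ^ (-(1 : ℝ) / 2)) N Θ ω : ℝ) : ℂ) := rfl
  rw [hfun]
  set δ : ℝ := R ^ (-(1 : ℝ) / 2) with hδdef
  have hδ : 0 < δ := Real.rpow_pos_of_pos hR0 _
  have hδ1 : δ ≤ 1 := Real.rpow_le_one_of_one_le_of_nonpos hR (by norm_num)
  have hNδ : N * δ < 1 := by
    calc N * δ < R ^ ((1 : ℝ) / 2) * δ := by gcongr
      _ = 1 := by rw [hδdef, ← Real.rpow_add hR0]; norm_num
  have hδ2 : 1 / δ ^ 2 = R := by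
    rw [hδdef, ← Real.rpow_natCast, ← Real.rpow_mul hR0.le]
    norm_num [Real.rpow_neg_one]
  obtain ⟨X, T, G, hX, hT, hXR, hTR, hG, hV, hB, hK⟩ := htest δ N hδ hδ1 hN hNδ
  rw [hδ2] at hXR hTR
  rw [← div_eq_mul_inv] at hsupp
  have hmain := le_LpBall_extOp (continuous_bundleReal δ N hsmooth.continuous)
    (fun ω => Finset.sum_nonneg fun n _ => (hbd _).1) hG hX hT hXR hTR hp2
    (B := 4 * N) (κ := 1 / 2) (I := δ) (by positivity) (by norm_num) hB
    (fun ω hω => by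
      obtain ⟨n, hn, h⟩ := exists_abs_sub_le_of_bundleReal_ne_zero hsupp hω
      exact hK ω n hn h)
    (le_integral_bundleReal hδ hN hNδ.le hsmooth.continuous (fun ω => (hbd ω).1) fun ω h =>
      hone ω (h.trans_eq (by field_simp)))
  refine le_trans (ENNReal.ofReal_le_ofReal ?_) hmain
  have hp0 : 0 < p := by linarith
  have hδ3 : a * N / δ ^ 3 = a * N * R ^ (3 / 2 : ℝ) := by
    rw [div_eq_mul_inv, hδdef, ← Real.rpow_natCast, ← Real.rpow_mul hR0.le,
      ← Real.rpow_neg hR0.le]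
    norm_num
  have hVp : (a * N * R ^ (3 / 2 : ℝ)) ^ (1 / p) =
      a ^ (1 / p) * (N : ℝ) ^ (1 / p) * R ^ (3 / (2 * p)) := by
    rw [Real.mul_rpow (by positivity) (by positivity), Real.mul_rpow ha.le hN0.le,
      ← Real.rpow_mul hR0.le]
    congr 2
    field_simp
  have hsqrt : √(4 * (N : ℝ)) = 2 * (N : ℝ) ^ (1 / 2 : ℝ) := by
    rw [Real.sqrt_mul (by norm_num), ← Real.sqrt_eq_rpow,
      show (4 : ℝ) = 2 ^ 2 by norm_num, Real.sqrt_sq (by norm_num)]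
  calc a ^ (1 / p) / 4 * R ^ (3 / (2 * p) - 1 / 2 - ε) * (N : ℝ) ^ (1 / p - 1 / 2)
      ≤ a ^ (1 / p) / 4 * R ^ (3 / (2 * p) + -1 / 2) * (N : ℝ) ^ (1 / p - 1 / 2) := by
        gcongr
        linarith
    _ = 1 / 2 * δ * (a * N / δ ^ 3) ^ (1 / p) / √(4 * N) := by
        rw [hδ3, hVp, hsqrt, Real.rpow_add hR0, ← hδdef, Real.rpow_sub hN0]
        field_simp
        norm_num
    _ ≤ 1 / 2 * δ * (X * T) ^ (1 / p) / √(4 * N) := by gcongr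

end
end

section
/- For every ε > 0 there is a constant C_ε such that for all R ≥ 1 and all positive integers N with N < R^{1/2}, one has ‖Ef_{R,N}‖_{L⁶(B_R)} ≤ C_ε · R^{-1/4 + ε} · N^{-1/3}. -/
open MeasureTheory Real Set ENNReal

noncomputable section

theorem succ_le_mul_rpow {ε : ℝ} (hε : 0 < ε) {D : ℝ} (hD : 1 ≤ D)
    (hD' : 1 ≤ D * (ε * Real.log 2)) {p : ℕ} (hp : 2 ≤ p) (k : ℕ) : ((k : ℝ) + 1) ≤ D * ((p : ℝ) ^ k) ^ ε := by
  have h2 : (2 : ℝ) ≤ p := by exact_mod_cast hp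
  have h1 : ε * Real.log 2 * k + 1 ≤ ((p : ℝ) ^ k) ^ ε := by
    rw [Real.rpow_def_of_pos (by positivity), Real.log_pow]
    have hl : Real.log 2 ≤ Real.log p := Real.log_le_log (by norm_num) h2
    have := Real.add_one_le_exp ((k : ℝ) * Real.log p * ε)
    have h3 : ε * Real.log 2 * k ≤ (k : ℝ) * Real.log p * ε := by
      have : (k : ℝ) * ε * Real.log 2 ≤ k * ε * Real.log p := by gcongr
      linarith
    linarith
  have hk : (0 : ℝ) ≤ k := by positivity
  calc (k : ℝ) + 1 ≤ D * (ε * Real.log 2) * k + D := by nlinarith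
    _ = D * (ε * Real.log 2 * k + 1) := by ring
    _ ≤ _ := by gcongr

theorem succ_le_rpow_of_large {ε : ℝ} (hε : 0 < ε) {p : ℕ} (hp : (2 : ℝ) ^ ε⁻¹ ≤ p) (k : ℕ) :
    ((k : ℝ) + 1) ≤ ((p : ℝ) ^ k) ^ ε := by
  have h2 : (2 : ℝ) ≤ (p : ℝ) ^ ε := by
    calc (2 : ℝ) = ((2 : ℝ) ^ ε⁻¹) ^ ε := by
          rw [← Real.rpow_mul (by norm_num), inv_mul_cancel₀ hε.ne', Real.rpow_one]
      _ ≤ _ := by gcongr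
  have : ((p : ℝ) ^ k) ^ ε = ((p : ℝ) ^ ε) ^ k := by
    rw [← Real.rpow_natCast, ← Real.rpow_natCast, ← Real.rpow_mul (by positivity),
      ← Real.rpow_mul (by positivity), mul_comm]
  rw [this]
  calc (k : ℝ) + 1 ≤ 2 ^ k := by exact_mod_cast Nat.lt_two_pow_self
    _ ≤ _ := by gcongr

/-- The divisor bound: `d(n) ≤ C n ^ ε`. -/
theorem card_divisors_le_rpow {ε : ℝ} (hε : 0 < ε) :
    ∃ C : ℝ, 0 < C ∧ ∀ n : ℕ, n ≠ 0 → (n.divisors.card : ℝ) ≤ C * (n : ℝ) ^ ε := by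
  obtain ⟨P, hP⟩ := exists_nat_ge ((2 : ℝ) ^ ε⁻¹)
  have hl : 0 < ε * Real.log 2 := mul_pos hε (Real.log_pos (by norm_num))
  set D : ℝ := max 1 (ε * Real.log 2)⁻¹ with hDdef
  have hD : 1 ≤ D := le_max_left _ _
  have hD' : 1 ≤ D * (ε * Real.log 2) := by
    calc (1 : ℝ) = (ε * Real.log 2)⁻¹ * (ε * Real.log 2) := (inv_mul_cancel₀ hl.ne').symm
      _ ≤ _ := by gcongr; exact le_max_right _ _
  refine ⟨D ^ P, by positivity, fun n hn => ?_⟩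
  have hfac : (n : ℝ) ^ ε = ∏ p ∈ n.primeFactors, ((p : ℝ) ^ n.factorization p) ^ ε := by
    rw [Real.finsetProd_rpow _ _ (fun i _ => by positivity)]
    congr 1
    conv_lhs => rw [← Nat.prod_factorization_pow_eq_self hn]
    rw [Finsupp.prod, Nat.support_factorization]
    push_cast
    rfl
  rw [Nat.card_divisors hn, hfac]
  push_cast
  calc ∏ p ∈ n.primeFactors, ((n.factorization p : ℝ) + 1)
      ≤ ∏ p ∈ n.primeFactors, ((if p < P then D else 1) * ((p : ℝ) ^ n.factorization p) ^ ε) := by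
        refine Finset.prod_le_prod (fun i _ => by positivity) fun p hp => ?_
        split_ifs with h
        · exact succ_le_mul_rpow hε hD hD' (Nat.prime_of_mem_primeFactors hp).two_le _
        · rw [one_mul]
          exact succ_le_rpow_of_large hε (hP.trans (by exact_mod_cast not_lt.mp h)) _
    _ = (∏ p ∈ n.primeFactors, (if p < P then D else 1)) *
          ∏ p ∈ n.primeFactors, ((p : ℝ) ^ n.factorization p) ^ ε := Finset.prod_mul_distrib
    _ ≤ _ := by
        gcongr
        rw [Finset.prod_ite, Finset.prod_const, Finset.prod_const_one, mul_one]
        refine pow_le_pow_right₀ hD ?_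
        calc _ ≤ (Finset.range P).card := Finset.card_le_card fun x hx => by
              simpa using (Finset.mem_filter.mp hx).2
          _ = P := Finset.card_range P

/-- Pairs of triples in `[-N, N]` whose sums, and sums of squares, differ by `a` and `b`. -/
def vinogradovSet (N : ℕ) (a b : ℤ) : Finset ((ℤ × ℤ × ℤ) × (ℤ × ℤ × ℤ)) :=
  let s := Finset.Icc (-(N : ℤ)) N
  ((s ×ˢ s ×ˢ s) ×ˢ (s ×ˢ s ×ˢ s)).filter fun p =>
    p.1.1 + p.1.2.1 + p.1.2.2 - (p.2.1 + p.2.2.1 + p.2.2.2) = a ∧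
    p.1.1 ^ 2 + p.1.2.1 ^ 2 + p.1.2.2 ^ 2 - (p.2.1 ^ 2 + p.2.2.1 ^ 2 + p.2.2.2 ^ 2) = b

theorem card_le_mul_of_maps_triple {N : ℕ} {M : ℕ} (S : Finset ((ℤ × ℤ × ℤ) × (ℤ × ℤ × ℤ)))
    (F : (ℤ × ℤ × ℤ) × (ℤ × ℤ × ℤ) → ℤ × ℤ × ℤ)
    (hF : ∀ p ∈ S, F p ∈ Finset.Icc (-(N : ℤ)) N ×ˢ Finset.Icc (-(N : ℤ)) N ×ˢ
      Finset.Icc (-(N : ℤ)) N)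
    (hM : ∀ q, (S.filter fun p => F p = q).card ≤ M) : S.card ≤ M * (2 * N + 1) ^ 3 := by
  classical
  have h := Finset.card_le_mul_card_image_of_maps_to hF M fun q _ => hM q
  refine h.trans (Nat.mul_le_mul_left _ ?_)
  have : (Finset.Icc (-(N : ℤ)) N).card = 2 * N + 1 := by simp; omega
  rw [Finset.card_product, Finset.card_product, this]
  exact le_of_eq (by ring)

theorem mem_vinogradovSet {N : ℕ} {a b x₁ x₂ x₃ y₁ y₂ y₃ : ℤ} :
    ((x₁, x₂, x₃), (y₁, y₂, y₃)) ∈ vinogradovSet N a b ↔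
      ((x₁ ∈ Finset.Icc (-(N : ℤ)) N ∧ x₂ ∈ Finset.Icc (-(N : ℤ)) N ∧
          x₃ ∈ Finset.Icc (-(N : ℤ)) N) ∧
        (y₁ ∈ Finset.Icc (-(N : ℤ)) N ∧ y₂ ∈ Finset.Icc (-(N : ℤ)) N ∧
          y₃ ∈ Finset.Icc (-(N : ℤ)) N)) ∧
      x₁ + x₂ + x₃ - (y₁ + y₂ + y₃) = a ∧
      x₁ ^ 2 + x₂ ^ 2 + x₃ ^ 2 - (y₁ ^ 2 + y₂ ^ 2 + y₃ ^ 2) = b := by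
  simp only [vinogradovSet, Finset.mem_filter, Finset.mem_product]

/-- Three integer solutions of `(c - x)² = d - x²` cannot be pairwise distinct. -/
theorem eq_of_three_roots {c d x y z : ℤ} (hx : (c - x) ^ 2 = d - x ^ 2)
    (hy : (c - y) ^ 2 = d - y ^ 2) (hz : (c - z) ^ 2 = d - z ^ 2) (hxy : x ≠ y) (hxz : x ≠ z) :
    y = z := by
  have h1 : (x - y) * (x + y - c) = 0 := by linarith
  have h2 : (x - z) * (x + z - c) = 0 := by linarith
  have h1' := (mul_eq_zero.mp h1).resolve_left (sub_ne_zero.mpr hxy)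
  have h2' := (mul_eq_zero.mp h2).resolve_left (sub_ne_zero.mpr hxz)
  omega

theorem card_vinogradovSet_filter_right (N : ℕ) (a b : ℤ) :
    ((vinogradovSet N a b).filter fun p => p.1.2.1 = p.2.1).card ≤ 2 * (2 * N + 1) ^ 3 := by
  refine card_le_mul_of_maps_triple _ (fun p => (p.2.1, p.2.2.1, p.2.2.2)) ?_ ?_
  · rintro ⟨⟨x₁, x₂, x₃⟩, y₁, y₂, y₃⟩ hp
    obtain ⟨hp, -⟩ := Finset.mem_filter.mp hp
    rw [mem_vinogradovSet] at hp
    simp only [Finset.mem_product]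
    tauto
  · rintro ⟨q₁, q₂, q₃⟩
    by_contra! hcard
    obtain ⟨⟨⟨u₁, u₂, u₃⟩, u₄, u₅, u₆⟩, hu, ⟨⟨v₁, v₂, v₃⟩, v₄, v₅, v₆⟩, hv,
      ⟨⟨w₁, w₂, w₃⟩, w₄, w₅, w₆⟩, hw, huv, huw, hvw⟩ := Finset.two_lt_card.mp hcard
    simp only [Finset.mem_filter, mem_vinogradovSet, Prod.mk.injEq] at hu hv hw
    obtain ⟨⟨⟨-, hu₁, hu₂⟩, rfl⟩, rfl, rfl, rfl⟩ := hu
    obtain ⟨⟨⟨-, hv₁, hv₂⟩, rfl⟩, rfl, rfl, rfl⟩ := hv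
    obtain ⟨⟨⟨-, hw₁, hw₂⟩, rfl⟩, rfl, rfl, rfl⟩ := hw
    have root : ∀ x₁ x₂ x₃ : ℤ, x₁ + x₂ + x₃ - (x₂ + w₅ + w₆) = a →
        x₁ ^ 2 + x₂ ^ 2 + x₃ ^ 2 - (x₂ ^ 2 + w₅ ^ 2 + w₆ ^ 2) = b →
        (a + w₅ + w₆ - x₃) ^ 2 = (b + w₅ ^ 2 + w₆ ^ 2) - x₃ ^ 2 := by
      intro x₁ x₂ x₃ h1 h2
      rw [show a + w₅ + w₆ - x₃ = x₁ by linarith]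
      linarith
    have huv' : u₃ ≠ v₃ := by
      rintro rfl
      exact huv (by rw [show u₁ = v₁ by linarith])
    have huw' : u₃ ≠ w₃ := by
      rintro rfl
      exact huw (by rw [show u₁ = w₁ by linarith])
    have := eq_of_three_roots (root _ _ _ hu₁ hu₂) (root _ _ _ hv₁ hv₂) (root _ _ _ hw₁ hw₂)
      huv' huw'
    subst this
    exact hvw (by rw [show v₁ = w₁ by linarith])

theorem card_vinogradovSet_filter_left (N : ℕ) (a b : ℤ) :
    ((vinogradovSet N a b).filter fun p => p.1.1 = p.2.1).card ≤ 2 * (2 * N + 1) ^ 3 := by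
  refine le_trans (le_of_eq ?_) (card_vinogradovSet_filter_right N a b)
  refine Finset.card_nbij' (fun p => ((p.1.2.1, p.1.1, p.1.2.2), p.2))
    (fun p => ((p.1.2.1, p.1.1, p.1.2.2), p.2)) ?_ ?_ ?_ ?_
  · rintro ⟨⟨x₁, x₂, x₃⟩, y₁, y₂, y₃⟩ hp
    simp only [Finset.coe_filter, Set.mem_ofPred_eq, mem_vinogradovSet] at hp ⊢
    refine ⟨⟨by tauto, by linarith, by linarith⟩, by tauto⟩
  · rintro ⟨⟨x₁, x₂, x₃⟩, y₁, y₂, y₃⟩ hp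
    simp only [Finset.coe_filter, Set.mem_ofPred_eq, mem_vinogradovSet] at hp ⊢
    refine ⟨⟨by tauto, by linarith, by linarith⟩, by tauto⟩
  · rintro ⟨⟨x₁, x₂, x₃⟩, y₁, y₂, y₃⟩ _
    rfl
  · rintro ⟨⟨x₁, x₂, x₃⟩, y₁, y₂, y₃⟩ _
    rfl

theorem card_vinogradovSet_filter_generic {N M : ℕ} {a b : ℤ}
    (hM : ∀ m : ℤ, m ≠ 0 → |m| ≤ (|a| + 3 * N) ^ 2 + (|b| + 3 * N ^ 2) →
      m.natAbs.divisors.card ≤ M) :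
    ((vinogradovSet N a b).filter fun p => p.1.1 ≠ p.2.1 ∧ p.1.2.1 ≠ p.2.1).card ≤
      (M * 2) * (2 * N + 1) ^ 3 := by
  refine card_le_mul_of_maps_triple _ (fun p => (p.1.2.2, p.2.2.1, p.2.2.2)) ?_ ?_
  · rintro ⟨⟨x₁, x₂, x₃⟩, y₁, y₂, y₃⟩ hp
    obtain ⟨hp, -⟩ := Finset.mem_filter.mp hp
    rw [mem_vinogradovSet] at hp
    simp only [Finset.mem_product]
    tauto
  · rintro ⟨x₃, y₂, y₃⟩
    set A := a - x₃ + y₂ + y₃ with hA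
    set B := b - x₃ ^ 2 + y₂ ^ 2 + y₃ ^ 2 with hB
    set T := ((vinogradovSet N a b).filter fun p => p.1.1 ≠ p.2.1 ∧ p.1.2.1 ≠ p.2.1).filter
      fun p => (p.1.2.2, p.2.2.1, p.2.2.2) = (x₃, y₂, y₃) with hT
    have key : ∀ x₁ x₂ x₃' y₁ y₂' y₃', ((x₁, x₂, x₃'), (y₁, y₂', y₃')) ∈ T →
        x₃' = x₃ ∧ y₂' = y₂ ∧ y₃' = y₃ ∧ x₁ = A + (y₁ - x₂) ∧ x₁ ≠ y₁ ∧ x₂ ≠ y₁ ∧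
          A ^ 2 - B = 2 * (y₁ - x₂) * (y₁ - x₁) ∧
          |A ^ 2 - B| ≤ (|a| + 3 * N) ^ 2 + (|b| + 3 * N ^ 2) := by
      intro x₁ x₂ x₃' y₁ y₂' y₃' hp
      simp only [hT, Finset.mem_filter, mem_vinogradovSet, Prod.mk.injEq, Finset.mem_Icc] at hp
      obtain ⟨⟨⟨hbox, h1, h2⟩, h3, h4⟩, rfl, rfl, rfl⟩ := hp
      have hA' : A = x₁ + x₂ - y₁ := by omega
      have hB' : B = x₁ ^ 2 + x₂ ^ 2 - y₁ ^ 2 := by linarith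
      refine ⟨rfl, rfl, rfl, by omega, h3, h4, by rw [hA', hB']; ring, ?_⟩
      obtain ⟨⟨-, -, hx3⟩, -, hy2, hy3⟩ := hbox
      have ex := sq_le_sq' hx3.1 hx3.2
      have e2 := sq_le_sq' hy2.1 hy2.2
      have e3 := sq_le_sq' hy3.1 hy3.2
      have hAb : |A| ≤ |a| + 3 * N := by
        rw [abs_le]; constructor <;> linarith [neg_abs_le a, le_abs_self a]
      have hBb : |B| ≤ |b| + 3 * N ^ 2 := by
        have := sq_nonneg x₃'; have := sq_nonneg y₂'; have := sq_nonneg y₃'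
        rw [abs_le]; constructor <;> linarith [neg_abs_le b, le_abs_self b]
      calc |A ^ 2 - B| ≤ |A ^ 2| + |B| := abs_sub _ _
        _ = |A| ^ 2 + |B| := by rw [abs_pow]
        _ ≤ _ := by gcongr
    rcases T.eq_empty_or_nonempty with h0 | ⟨⟨⟨z₁, z₂, z₃⟩, w₁, w₂, w₃⟩, hne⟩
    · rw [h0]; simp
    obtain ⟨-, -, -, -, hz1, hz2, hm, hmb⟩ := key _ _ _ _ _ _ hne
    have hm0 : A ^ 2 - B ≠ 0 := by
      rw [hm]
      exact mul_ne_zero (mul_ne_zero two_ne_zero (sub_ne_zero.mpr hz2.symm))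
        (sub_ne_zero.mpr hz1.symm)
    calc T.card ≤ ((A ^ 2 - B).natAbs.divisors ×ˢ (Finset.univ : Finset Bool)).card := by
          refine Finset.card_le_card_of_injOn
            (fun p => ((p.2.1 - p.1.2.1).natAbs, decide (0 < p.2.1 - p.1.2.1))) ?_ ?_
          · rintro ⟨⟨x₁, x₂, x₃'⟩, y₁, y₂', y₃'⟩ hp
            obtain ⟨-, -, -, -, -, -, h, -⟩ := key _ _ _ _ _ _ hp
            simp only [Finset.coe_product, Finset.coe_univ, Set.mem_prod, Finset.mem_coe,
              Nat.mem_divisors, Set.mem_univ, and_true]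
            refine ⟨Int.natAbs_dvd_natAbs.mpr ⟨2 * (y₁ - x₁), by rw [h]; ring⟩, by simpa using hm0⟩
          · rintro ⟨⟨x₁, x₂, x₃'⟩, y₁, y₂', y₃'⟩ hp ⟨⟨u₁, u₂, u₃'⟩, v₁, v₂', v₃'⟩ hq heq
            obtain ⟨rfl, rfl, rfl, h1, h2, h3, h4, -⟩ := key _ _ _ _ _ _ hp
            obtain ⟨rfl, rfl, rfl, k1, k2, k3, k4, -⟩ := key _ _ _ _ _ _ hq
            simp only [Prod.mk.injEq, decide_eq_decide] at heq
            have hd : y₁ - x₂ = v₁ - u₂ := by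
              rcases Int.natAbs_eq_natAbs_iff.mp heq.1 with h | h <;> omega
            have hx : x₁ = u₁ := by linarith
            rw [k4, ← hd] at h4
            have hy := mul_left_cancel₀ (mul_ne_zero two_ne_zero (sub_ne_zero.mpr h3.symm)) h4
            have hy₁ : y₁ = v₁ := by linarith
            have hx₂ : x₂ = u₂ := by linarith
            subst hx hy₁ hx₂
            rfl
      _ = (A ^ 2 - B).natAbs.divisors.card * 2 := by simp [Finset.card_product]
      _ ≤ M * 2 := Nat.mul_le_mul_right _ (hM _ hm0 hmb)

theorem card_vinogradovSet_le {ε : ℝ} (hε : 0 < ε) (K : ℕ) :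
    ∃ C : ℝ, 0 < C ∧ ∀ N : ℕ, 0 < N → ∀ a b : ℤ, |a| ≤ K → |b| ≤ K →
      ((vinogradovSet N a b).card : ℝ) ≤ C * (N : ℝ) ^ (3 + ε) := by
  obtain ⟨C, hC, hdiv⟩ := card_divisors_le_rpow (half_pos hε)
  set L : ℝ := (K + 3) ^ 2 + (K + 3) with hL
  refine ⟨27 * (4 + 2 * (C * L ^ (ε / 2))), by positivity, fun N hN a b ha hb => ?_⟩
  have hN1 : (1 : ℝ) ≤ N := by exact_mod_cast hN
  set M : ℕ := ⌊C * L ^ (ε / 2) * (N : ℝ) ^ ε⌋₊ with hMdef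
  have hM : ∀ m : ℤ, m ≠ 0 → |m| ≤ (|a| + 3 * N) ^ 2 + (|b| + 3 * N ^ 2) →
      m.natAbs.divisors.card ≤ M := by
    intro m hm hmb
    refine Nat.le_floor ((hdiv _ (Int.natAbs_ne_zero.mpr hm)).trans ?_)
    have h1 : ((m.natAbs : ℕ) : ℝ) ≤ L * (N : ℝ) ^ 2 := by
      have h2 : ((m.natAbs : ℕ) : ℝ) = ((|m| : ℤ) : ℝ) := by
        rw [← Nat.cast_natAbs]
      have h3 : ((|m| : ℤ) : ℝ) ≤
          (((|a| : ℤ) : ℝ) + 3 * N) ^ 2 + (((|b| : ℤ) : ℝ) + 3 * N ^ 2) := by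
        exact_mod_cast hmb
      have ha' : ((|a| : ℤ) : ℝ) ≤ K := by exact_mod_cast ha
      have hb' : ((|b| : ℤ) : ℝ) ≤ K := by exact_mod_cast hb
      rw [h2]
      refine h3.trans ?_
      have hKN : (K : ℝ) ≤ K * N := le_mul_of_one_le_right (by positivity) hN1
      have hKN2 : (K : ℝ) ≤ K * N ^ 2 := le_mul_of_one_le_right (by positivity) (one_le_pow₀ hN1)
      have ha0 : (0 : ℝ) ≤ ((|a| : ℤ) : ℝ) := by positivity
      calc (((|a| : ℤ) : ℝ) + 3 * N) ^ 2 + (((|b| : ℤ) : ℝ) + 3 * N ^ 2)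
          ≤ ((K : ℝ) * N + 3 * N) ^ 2 + ((K : ℝ) * N ^ 2 + 3 * N ^ 2) := by
            gcongr <;> linarith
        _ = L * (N : ℝ) ^ 2 := by rw [hL]; ring
    calc C * ((m.natAbs : ℕ) : ℝ) ^ (ε / 2) ≤ C * (L * (N : ℝ) ^ 2) ^ (ε / 2) := by gcongr
      _ = C * L ^ (ε / 2) * (N : ℝ) ^ ε := by
        rw [Real.mul_rpow (by positivity) (by positivity), ← Real.rpow_natCast (N : ℝ) 2,
          ← Real.rpow_mul (by positivity), mul_assoc]
        congr 3
        push_cast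
        ring
  have hcard : (vinogradovSet N a b).card ≤ (4 + M * 2) * (2 * N + 1) ^ 3 := by
    classical
    have hsub : vinogradovSet N a b ⊆
        ((vinogradovSet N a b).filter fun p => p.1.2.1 = p.2.1) ∪
        ((vinogradovSet N a b).filter fun p => p.1.1 = p.2.1) ∪
        ((vinogradovSet N a b).filter fun p => p.1.1 ≠ p.2.1 ∧ p.1.2.1 ≠ p.2.1) := by
      intro p hp
      simp only [Finset.mem_union, Finset.mem_filter]
      tauto
    have h1 := card_vinogradovSet_filter_right N a b
    have h2 := card_vinogradovSet_filter_left N a b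
    have h3 := card_vinogradovSet_filter_generic hM
    refine (Finset.card_le_card hsub).trans ?_
    refine (Finset.card_union_le _ _).trans ?_
    refine (Nat.add_le_add_right (Finset.card_union_le _ _) _).trans ?_
    linarith
  have hMle : (M : ℝ) ≤ C * L ^ (ε / 2) * (N : ℝ) ^ ε := Nat.floor_le (by positivity)
  have hNε : (1 : ℝ) ≤ (N : ℝ) ^ ε := Real.one_le_rpow hN1 hε.le
  calc ((vinogradovSet N a b).card : ℝ) ≤ (4 + M * 2) * (2 * N + 1) ^ 3 := by exact_mod_cast hcard
    _ ≤ (4 * (N : ℝ) ^ ε + (C * L ^ (ε / 2) * (N : ℝ) ^ ε) * 2) * (3 * N) ^ 3 := by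
        gcongr <;> linarith
    _ = 27 * (4 + 2 * (C * L ^ (ε / 2))) * (N : ℝ) ^ (3 + ε) := by
        rw [Real.rpow_add (by positivity), show ((N : ℝ) ^ (3 : ℝ)) = (N : ℝ) ^ 3 by norm_cast]
        ring

section Majorant

open FourierTransform

theorem fourier_comp_add_right (g : ℝ → ℂ) (a ξ : ℝ) :
    𝓕 (fun x => g (x + a)) ξ = Complex.exp (Complex.I * ((2 * π * (a * ξ) : ℝ) : ℂ)) * 𝓕 g ξ := by
  rw [Real.fourier_real_eq_integral_exp_smul, Real.fourier_real_eq_integral_exp_smul,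
    ← integral_const_mul]
  rw [← integral_add_right_eq_self (μ := volume) (fun v : ℝ =>
    Complex.exp (Complex.I * ((2 * π * (a * ξ) : ℝ) : ℂ)) *
      Complex.exp (((-2 * π * v * ξ : ℝ) : ℂ) * Complex.I) • g v) a]
  refine integral_congr_ae (Filter.Eventually.of_forall fun v => ?_)
  simp only [smul_eq_mul]
  rw [← mul_assoc, ← Complex.exp_add]
  congr 2
  push_cast
  ring

theorem exists_schwartz_fourier_sq_band_limited :
    ∃ G : SchwartzMap ℝ ℂ, G 0 ≠ 0 ∧ ∀ a : ℝ, 4 < |a| →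
      ∫ ξ, Complex.exp (Complex.I * ((2 * π * (a * ξ) : ℝ) : ℂ)) * ((‖G ξ‖ ^ 2 : ℝ) : ℂ) = 0 := by
  let b : ContDiffBump (0 : ℝ) := ⟨1, 2, by norm_num, by norm_num⟩
  let g : ℝ → ℂ := fun x => (b x : ℂ)
  have hg : ContDiff ℝ (⊤ : ℕ∞) g := Complex.ofRealCLM.contDiff.comp b.contDiff
  have hgc : HasCompactSupport g := b.hasCompactSupport.comp_left (g := ((↑) : ℝ → ℂ)) (by simp)
  let gS : SchwartzMap ℝ ℂ := hgc.toSchwartzMap hg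
  refine ⟨𝓕 gS, ?_, fun a ha => ?_⟩
  · rw [SchwartzMap.fourier_coe, Real.fourier_real_eq_integral_exp_smul]
    have : (∫ v : ℝ, Complex.exp (((-2 * π * v * 0 : ℝ) : ℂ) * Complex.I) • gS v) =
        ((∫ v : ℝ, b v : ℝ) : ℂ) := by
      rw [← integral_complex_ofReal]
      refine integral_congr_ae (Filter.Eventually.of_forall fun v => ?_)
      simp [gS, g]
    rw [this]
    exact_mod_cast b.integral_pos.ne'
  · let ga : ℝ → ℂ := fun x => g (x + a)
    have hga : ContDiff ℝ (⊤ : ℕ∞) ga := hg.comp (contDiff_id.add contDiff_const)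
    have hgac : HasCompactSupport ga := hgc.comp_homeomorph (Homeomorph.addRight a)
    let gaS : SchwartzMap ℝ ℂ := hgac.toSchwartzMap hga
    have hP := SchwartzMap.integral_inner_fourier_fourier gS gaS
    have h1 : ∀ ξ, inner ℂ (𝓕 gS ξ) (𝓕 gaS ξ) =
        Complex.exp (Complex.I * ((2 * π * (a * ξ) : ℝ) : ℂ)) * ((‖𝓕 gS ξ‖ ^ 2 : ℝ) : ℂ) := by
      intro ξ
      have : 𝓕 gaS ξ = Complex.exp (Complex.I * ((2 * π * (a * ξ) : ℝ) : ℂ)) * 𝓕 gS ξ :=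
        fourier_comp_add_right g a ξ
      rw [this, RCLike.inner_apply, mul_assoc, Complex.mul_conj, Complex.normSq_eq_norm_sq]
    simp_rw [h1] at hP
    rw [hP]
    refine integral_eq_zero_of_ae (Filter.Eventually.of_forall fun x => ?_)
    have : g x = 0 ∨ g (x + a) = 0 := by
      by_contra! hne
      have hx : |x| < 2 := by
        have : x ∈ Function.support b := by simpa [g] using hne.1
        rw [b.support_eq] at this
        simpa using this
      have hxa : |x + a| < 2 := by
        have : x + a ∈ Function.support b := by simpa [g] using hne.2
        rw [b.support_eq] at this
        simpa using this
      have : |a| ≤ |x + a| + |x| := by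
        simpa using abs_sub (x + a) x
      linarith
    change inner ℂ (g x) (g (x + a)) = 0
    rcases this with h | h <;> simp [h]

/-- A nonnegative majorant of the unit interval with compactly supported Fourier transform. -/
theorem exists_band_limited_majorant :
    ∃ (φ : ℝ → ℝ) (c : ℝ), 0 < c ∧ Continuous φ ∧ Integrable φ ∧ (∀ x, 0 ≤ φ x) ∧
      (∀ x, |x| ≤ 1 → 1 ≤ φ x) ∧
      ∀ a : ℝ, c < |a| → ∫ x, Complex.exp (Complex.I * ((a * x : ℝ) : ℂ)) * (φ x : ℂ) = 0 := by
  obtain ⟨G, hG0, hG⟩ := exists_schwartz_fourier_sq_band_limited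
  have hcont : Continuous fun x => ‖G x‖ ^ 2 := by fun_prop
  set m : ℝ := ‖G 0‖ ^ 2 / 2 with hm
  have hmpos : 0 < m := by positivity
  have hev : ∀ᶠ x in nhds (0 : ℝ), m < ‖G x‖ ^ 2 :=
    hcont.continuousAt.eventually (lt_mem_nhds (by rw [hm]; linarith))
  obtain ⟨ρ, hρ, hball⟩ := Metric.eventually_nhds_iff.mp hev
  set r := ρ / 2 with hr
  have hrpos : 0 < r := by positivity
  have hint : Integrable fun x => ‖G x‖ ^ 2 := by
    have := (G.memLp 2 volume).integrable_norm_pow (p := 2) (by norm_num)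
    simpa using this
  refine ⟨fun x => m⁻¹ * ‖G (r * x)‖ ^ 2, 4 * (2 * π * r), by positivity, by fun_prop,
    (hint.comp_mul_left' hrpos.ne').const_mul _, fun x => by positivity, fun x hx => ?_,
    fun a ha => ?_⟩
  · have : m < ‖G (r * x)‖ ^ 2 := hball (by
      rw [dist_zero_right, Real.norm_eq_abs, abs_mul, abs_of_pos hrpos]
      nlinarith)
    change 1 ≤ m⁻¹ * ‖G (r * x)‖ ^ 2
    rw [inv_mul_eq_div, le_div_iff₀ hmpos]
    linarith
  · have h := hG (a / (2 * π * r)) (by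
      rw [abs_div, abs_of_pos (by positivity : 0 < 2 * π * r), lt_div_iff₀ (by positivity)]
      exact ha)
    have h2 := Measure.integral_comp_mul_left (fun ξ : ℝ =>
      Complex.exp (Complex.I * ((2 * π * (a / (2 * π * r) * ξ) : ℝ) : ℂ)) *
        ((‖G ξ‖ ^ 2 : ℝ) : ℂ)) r
    rw [h, smul_zero] at h2
    rw [← mul_zero ((m⁻¹ : ℝ) : ℂ), ← h2, ← integral_const_mul]
    refine integral_congr_ae (Filter.Eventually.of_forall fun x => ?_)
    have : 2 * π * (a / (2 * π * r) * (r * x)) = a * x := by field_simp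
    simp only [this]
    push_cast
    ring

end Majorant

section LargeSieve

variable {U : Type*} [MeasurableSpace U]

/-- The weighted phase integral `∫ exp(i a x) φ(x / R) dx` is at most `R ∫ φ` in norm and vanishes
when `|a| > c / R`. -/
theorem norm_integral_exp_majorant_le {φ : ℝ → ℝ} {c R : ℝ} (hR : 0 < R)
    (hφ0 : ∀ x, 0 ≤ φ x)
    (hφ : ∀ a : ℝ, c < |a| → ∫ x, Complex.exp (Complex.I * ((a * x : ℝ) : ℂ)) * (φ x : ℂ) = 0)
    (a : ℝ) :
    ‖∫ x, Complex.exp (Complex.I * ((a * x : ℝ) : ℂ)) * (φ (x / R) : ℂ)‖ ≤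
      if |a| ≤ c / R then R * ∫ x, φ x else 0 := by
  have h := Measure.integral_comp_div (fun x : ℝ =>
    Complex.exp (Complex.I * ((a * R * x : ℝ) : ℂ)) * (φ x : ℂ)) R
  have h1 : ∀ x : ℝ, a * R * (x / R) = a * x := fun x => by field_simp
  simp only [h1] at h
  rw [h, abs_of_pos hR]
  split_ifs with hc
  · rw [norm_smul, Real.norm_of_nonneg hR.le]
    gcongr
    refine (norm_integral_le_integral_norm _).trans (le_of_eq ?_)
    refine integral_congr_ae (Filter.Eventually.of_forall fun x => ?_)
    simp only [norm_mul, mul_comm Complex.I, Complex.norm_exp_ofReal_mul_I, one_mul,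
      Complex.norm_real, Real.norm_of_nonneg (hφ0 x)]
  · rw [hφ (a * R) (by
      rw [abs_mul, abs_of_pos hR]
      exact (div_lt_iff₀ hR).mp (not_le.mp hc)), smul_zero, norm_zero]

theorem lintegral_ball_enorm_sq_le (ν : Measure U) [IsFiniteMeasure ν] {A B : U → ℝ}
    (hA : Measurable A) (hB : Measurable B) {φ : ℝ → ℝ} {c R : ℝ} (hR : 0 < R)
    (hφc : Continuous φ) (hφi : Integrable φ) (hφ0 : ∀ x, 0 ≤ φ x)
    (hφ1 : ∀ x, |x| ≤ 1 → 1 ≤ φ x)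
    (hφ : ∀ a : ℝ, c < |a| → ∫ x, Complex.exp (Complex.I * ((a * x : ℝ) : ℂ)) * (φ x : ℂ) = 0) :
    ∫⁻ z in Metric.ball (0 : ℝ × ℝ) R,
        ‖∫ u, Complex.exp (Complex.I * ((B u * z.2 + A u * z.1 : ℝ) : ℂ)) ∂ν‖ₑ ^ 2 ≤
      ENNReal.ofReal ((R * ∫ x, φ x) ^ 2) *
        (ν.prod ν) {p | |A p.1 - A p.2| ≤ c / R ∧ |B p.1 - B p.2| ≤ c / R} := by
  set g : ℝ × ℝ → ℂ := fun z =>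
    ∫ u, Complex.exp (Complex.I * ((B u * z.2 + A u * z.1 : ℝ) : ℂ)) ∂ν with hg
  set W : ℝ × ℝ → ℝ := fun z => φ (z.1 / R) * φ (z.2 / R) with hW
  set E : Set (U × U) := {p | |A p.1 - A p.2| ≤ c / R ∧ |B p.1 - B p.2| ≤ c / R} with hE
  set k : U → ℝ × ℝ → ℂ := fun u z =>
    Complex.exp (Complex.I * ((B u * z.2 + A u * z.1 : ℝ) : ℂ)) with hk
  have hkn : ∀ u z, ‖k u z‖ = 1 := fun u z => by
    rw [hk]; simp only [mul_comm Complex.I, Complex.norm_exp_ofReal_mul_I]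
  have hW0 : ∀ z, 0 ≤ W z := fun z => mul_nonneg (hφ0 _) (hφ0 _)
  have hWc : Continuous W := by fun_prop
  have hWi : Integrable W := (hφi.comp_div hR.ne').mul_prod (hφi.comp_div hR.ne')
  have hEm : MeasurableSet E := by
    have h : ∀ {D : U → ℝ}, Measurable D →
        MeasurableSet {p : U × U | |D p.1 - D p.2| ≤ c / R} := fun hD =>
      measurableSet_le ((hD.comp measurable_fst).sub (hD.comp measurable_snd)).abs
        measurable_const
    exact (h hA).inter (h hB)
  have hgm : StronglyMeasurable g := by
    refine StronglyMeasurable.integral_prod_right (f := fun z u => k u z) ?_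
    refine Measurable.stronglyMeasurable ?_
    simp only [hk, Function.uncurry_def]
    fun_prop
  have hgb : ∀ z, ‖g z‖ ≤ ν.real Set.univ := fun z => by
    refine (norm_integral_le_integral_norm _).trans (le_of_eq ?_)
    change ∫ u, ‖k u z‖ ∂ν = _
    simp [hkn]
  have hint : Integrable fun z => ‖g z‖ ^ 2 * W z := by
    refine hWi.bdd_mul (c := ν.real Set.univ ^ 2) (hgm.norm.pow 2).aestronglyMeasurable ?_
    refine Filter.Eventually.of_forall fun z => ?_
    rw [norm_pow, norm_norm]
    gcongr
    exact hgb z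
  have hsq : ∀ z, ((‖g z‖ ^ 2 * W z : ℝ) : ℂ) =
      ∫ p, k p.1 z * (starRingEnd ℂ) (k p.2 z) * (W z : ℂ) ∂(ν.prod ν) := fun z => by
    rw [integral_mul_const, integral_prod_mul (fun u => k u z)
      (fun u => (starRingEnd ℂ) (k u z)), integral_conj]
    push_cast
    rw [← Complex.mul_conj']
  have hkk : ∀ (p : U × U) z, k p.1 z * (starRingEnd ℂ) (k p.2 z) * (W z : ℂ) =
      (Complex.exp (Complex.I * (((A p.1 - A p.2) * z.1 : ℝ) : ℂ)) * (φ (z.1 / R) : ℂ)) *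
      (Complex.exp (Complex.I * (((B p.1 - B p.2) * z.2 : ℝ) : ℂ)) * (φ (z.2 / R) : ℂ)) := by
    intro p z
    simp only [hk, hW]
    rw [← Complex.exp_conj, ← Complex.exp_add, mul_mul_mul_comm, ← Complex.exp_add]
    congr 1
    · congr 1
      simp only [map_mul, Complex.conj_I, Complex.conj_ofReal]
      push_cast
      ring
    · push_cast
      ring
  have hswap : ((∫ z, ‖g z‖ ^ 2 * W z : ℝ) : ℂ) = ∫ p,
      (∫ x, Complex.exp (Complex.I * (((A p.1 - A p.2) * x : ℝ) : ℂ)) * (φ (x / R) : ℂ)) *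
      (∫ t, Complex.exp (Complex.I * (((B p.1 - B p.2) * t : ℝ) : ℂ)) * (φ (t / R) : ℂ))
      ∂(ν.prod ν) := by
    rw [← integral_complex_ofReal]
    simp_rw [hsq]
    rw [integral_integral_swap]
    · refine integral_congr_ae (Filter.Eventually.of_forall fun p => ?_)
      simp only [hkk]
      rw [Measure.volume_eq_prod]
      exact integral_prod_mul (fun x : ℝ =>
        Complex.exp (Complex.I * (((A p.1 - A p.2) * x : ℝ) : ℂ)) * (φ (x / R) : ℂ)) (fun t : ℝ =>
        Complex.exp (Complex.I * (((B p.1 - B p.2) * t : ℝ) : ℂ)) * (φ (t / R) : ℂ))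
    · refine (hWi.comp_fst (ν.prod ν)).mono' ?_ (Filter.Eventually.of_forall fun q => ?_)
      · refine Measurable.aestronglyMeasurable ?_
        simp only [Function.uncurry_def, hkk]
        fun_prop
      · simp only [Function.uncurry_def, norm_mul, RCLike.norm_conj, hkn, Complex.norm_real,
          Real.norm_of_nonneg (hW0 _), one_mul, le_refl]
  have hreal : ∫ z, ‖g z‖ ^ 2 * W z ≤ (R * ∫ x, φ x) ^ 2 * (ν.prod ν).real E := by
    calc ∫ z, ‖g z‖ ^ 2 * W z ≤ ‖((∫ z, ‖g z‖ ^ 2 * W z : ℝ) : ℂ)‖ := by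
          rw [Complex.norm_real]; exact le_abs_self _
      _ ≤ ∫ p, E.indicator (fun _ => (R * ∫ x, φ x) ^ 2) p ∂(ν.prod ν) := by
          rw [hswap]
          refine norm_integral_le_of_norm_le ((integrable_const _).indicator hEm)
            (Filter.Eventually.of_forall fun p => ?_)
          rw [norm_mul]
          have h1 := norm_integral_exp_majorant_le hR hφ0 hφ (A p.1 - A p.2)
          have h2 := norm_integral_exp_majorant_le hR hφ0 hφ (B p.1 - B p.2)
          have h0 : 0 ≤ R * ∫ x, φ x := mul_nonneg hR.le (integral_nonneg hφ0)
          refine (mul_le_mul h1 h2 (norm_nonneg _) (by split_ifs <;> simp [h0])).trans ?_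
          by_cases hA' : |A p.1 - A p.2| ≤ c / R <;> by_cases hB' : |B p.1 - B p.2| ≤ c / R <;>
            simp [hE, Set.indicator, hA', hB', pow_two]
      _ = (R * ∫ x, φ x) ^ 2 * (ν.prod ν).real E := by
          rw [integral_indicator_const _ hEm, smul_eq_mul, mul_comm]
  calc ∫⁻ z in Metric.ball (0 : ℝ × ℝ) R, ‖g z‖ₑ ^ 2
      ≤ ∫⁻ z in Metric.ball (0 : ℝ × ℝ) R, ENNReal.ofReal (‖g z‖ ^ 2 * W z) := by
        refine setLIntegral_mono' Metric.isOpen_ball.measurableSet fun z hz => ?_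
        rw [mem_ball_zero_iff, Prod.norm_def, max_lt_iff] at hz
        have hdiv : ∀ x : ℝ, ‖x‖ < R → |x / R| ≤ 1 := fun x hx => by
          rw [abs_div, abs_of_pos hR, div_le_one hR]; exact hx.le
        have : 1 ≤ W z := one_le_mul_of_one_le_of_one_le (hφ1 _ (hdiv _ hz.1)) (hφ1 _ (hdiv _ hz.2))
        rw [← ofReal_norm, ← ENNReal.ofReal_pow (norm_nonneg _)]
        exact ENNReal.ofReal_le_ofReal (le_mul_of_one_le_right (by positivity) this)
    _ ≤ ∫⁻ z, ENNReal.ofReal (‖g z‖ ^ 2 * W z) := setLIntegral_le_lintegral _ _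
    _ = ENNReal.ofReal (∫ z, ‖g z‖ ^ 2 * W z) :=
        (ofReal_integral_eq_lintegral_ofReal hint
          (Filter.Eventually.of_forall fun z => mul_nonneg (by positivity) (hW0 z))).symm
    _ ≤ ENNReal.ofReal ((R * ∫ x, φ x) ^ 2 * (ν.prod ν).real E) := ENNReal.ofReal_le_ofReal hreal
    _ = _ := by rw [ENNReal.ofReal_mul (by positivity), ofReal_measureReal]

end LargeSieve

section ProductCount

theorem prod_measure_band_le {X Y : Type*} [MeasurableSpace X] [MeasurableSpace Y] (a : Measure ℝ)
    (ha : a ≤ volume) [SFinite a] (b : Measure X) [SFinite b] (d : Measure Y) [SFinite d]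
    {f : X → ℝ} {g : Y → ℝ} (hf : Measurable f) (hg : Measurable g) (r : ℝ) :
    ((a.prod b).prod d) {p | |p.1.1 + f p.1.2 - g p.2| ≤ r} ≤
      ENNReal.ofReal (2 * r) * (b Set.univ * d Set.univ) := by
  have hm : MeasurableSet {p : (ℝ × X) × Y | |p.1.1 + f p.1.2 - g p.2| ≤ r} :=
    measurableSet_le (by fun_prop) measurable_const
  have hslice : ∀ (u : X) (y : Y), a {x | |x + f u - g y| ≤ r} ≤ ENNReal.ofReal (2 * r) := by
    intro u y
    refine (ha _).trans (le_of_eq ?_)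
    have : {x : ℝ | |x + f u - g y| ≤ r} = Icc (g y - f u - r) (g y - f u + r) := by
      ext x
      simp only [Set.mem_ofPred_eq, abs_le, Set.mem_Icc]
      constructor <;> rintro ⟨h1, h2⟩ <;> constructor <;> linarith
    rw [this, Real.volume_Icc]
    congr 1
    ring
  rw [Measure.prod_apply_symm hm]
  calc ∫⁻ y, (a.prod b) ((fun x => (x, y)) ⁻¹' {p | |p.1.1 + f p.1.2 - g p.2| ≤ r}) ∂d
      ≤ ∫⁻ _, ENNReal.ofReal (2 * r) * b Set.univ ∂d := by
        refine lintegral_mono fun y => ?_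
        rw [Measure.prod_apply_symm (measurable_prodMk_right hm)]
        calc _ ≤ ∫⁻ _, ENNReal.ofReal (2 * r) ∂b := lintegral_mono fun u => hslice u y
          _ = _ := lintegral_const _
    _ = _ := by rw [lintegral_const, mul_assoc]

/-- A lattice sextuple close to a real sextuple which nearly solves the quadratic system is itself
nearly a solution. -/
theorem abs_lattice_sums_le {δ N c : ℝ} (hδ : 0 < δ) (hδ1 : δ ≤ 1) (hN : 1 ≤ N) (hc : 0 ≤ c)
    {n ω : Fin 6 → ℝ} (hn : ∀ i, |n i| ≤ N) (hω : ∀ i, |ω i - n i * δ| ≤ δ * N⁻¹)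
    (h1 : |ω 0 + ω 1 + ω 2 - (ω 3 + ω 4 + ω 5)| ≤ c * δ ^ 2)
    (h2 : |ω 0 ^ 2 + ω 1 ^ 2 + ω 2 ^ 2 - (ω 3 ^ 2 + ω 4 ^ 2 + ω 5 ^ 2)| ≤ c * δ ^ 2) :
    |n 0 + n 1 + n 2 - (n 3 + n 4 + n 5)| ≤ c + 18 ∧
      |n 0 ^ 2 + n 1 ^ 2 + n 2 ^ 2 - (n 3 ^ 2 + n 4 ^ 2 + n 5 ^ 2)| ≤ c + 18 := by
  obtain ⟨y, rfl⟩ : ∃ y : Fin 6 → ℝ, ω = fun i => δ * y i :=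
    ⟨fun i => ω i / δ, by ext i; field_simp⟩
  have hN' : N⁻¹ ≤ 1 := inv_le_one_of_one_le₀ hN
  have hh : ∀ i, |y i - n i| ≤ N⁻¹ := fun i => by
    have := hω i
    rw [show δ * y i - n i * δ = δ * (y i - n i) by ring, abs_mul, abs_of_pos hδ] at this
    exact le_of_mul_le_mul_left this hδ
  have hy1 : |y 0 + y 1 + y 2 - (y 3 + y 4 + y 5)| ≤ c := by
    rw [show δ * y 0 + δ * y 1 + δ * y 2 - (δ * y 3 + δ * y 4 + δ * y 5) =
      δ * (y 0 + y 1 + y 2 - (y 3 + y 4 + y 5)) by ring, abs_mul, abs_of_pos hδ] at h1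
    refine le_of_mul_le_mul_left (h1.trans ?_) hδ
    nlinarith [mul_nonneg hc hδ.le]
  have hy2 : |y 0 ^ 2 + y 1 ^ 2 + y 2 ^ 2 - (y 3 ^ 2 + y 4 ^ 2 + y 5 ^ 2)| ≤ c := by
    rw [show (δ * y 0) ^ 2 + (δ * y 1) ^ 2 + (δ * y 2) ^ 2 -
      ((δ * y 3) ^ 2 + (δ * y 4) ^ 2 + (δ * y 5) ^ 2) =
      δ ^ 2 * (y 0 ^ 2 + y 1 ^ 2 + y 2 ^ 2 - (y 3 ^ 2 + y 4 ^ 2 + y 5 ^ 2)) by ring, abs_mul,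
      abs_of_pos (by positivity : 0 < δ ^ 2)] at h2
    exact le_of_mul_le_mul_left (h2.trans (le_of_eq (mul_comm _ _))) (by positivity)
  have hlin : ∀ i, |y i - n i| ≤ 1 := fun i => (hh i).trans hN'
  have hsq : ∀ i, |y i ^ 2 - n i ^ 2| ≤ 3 := fun i => by
    have hfac : y i ^ 2 - n i ^ 2 = (y i - n i) * (2 * n i + (y i - n i)) := by ring
    have hb : |2 * n i + (y i - n i)| ≤ 3 * N := by
      refine (abs_add_le _ _).trans ?_
      rw [abs_mul, abs_two]
      linarith [hn i, hlin i]
    rw [hfac, abs_mul]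
    calc |y i - n i| * |2 * n i + (y i - n i)| ≤ N⁻¹ * (3 * N) := by
          gcongr
          exact hh i
      _ = 3 := by field_simp
  simp only [abs_le] at hlin hsq hy1 hy2 ⊢
  refine ⟨⟨?_, ?_⟩, ?_, ?_⟩
  · linarith [hlin 0, hlin 1, hlin 2, hlin 3, hlin 4, hlin 5]
  · linarith [hlin 0, hlin 1, hlin 2, hlin 3, hlin 4, hlin 5]
  · linarith [hsq 0, hsq 1, hsq 2, hsq 3, hsq 4, hsq 5]
  · linarith [hsq 0, hsq 1, hsq 2, hsq 3, hsq 4, hsq 5]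

/-- The sum `x₁ + x₂ + x₃`. -/
def linSum (u : ℝ × ℝ × ℝ) : ℝ := u.1 + u.2.1 + u.2.2

/-- The sum `x₁² + x₂² + x₃²`. -/
def sqSum (u : ℝ × ℝ × ℝ) : ℝ := u.1 ^ 2 + u.2.1 ^ 2 + u.2.2 ^ 2

theorem measurable_linSum : Measurable linSum := by unfold linSum; fun_prop

theorem measurable_sqSum : Measurable sqSum := by unfold sqSum; fun_prop

/-- Lebesgue measure on the interval of radius `δ / N` about `n δ`. -/
def cellMeasure (δ : ℝ) (N : ℕ) (n : ℤ) : Measure ℝ :=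
  volume.restrict (Icc (n * δ - δ * (N : ℝ)⁻¹) (n * δ + δ * (N : ℝ)⁻¹))

instance (δ : ℝ) (N : ℕ) (n : ℤ) : IsFiniteMeasure (cellMeasure δ N n) := by
  unfold cellMeasure; infer_instance

theorem cellMeasure_univ (δ : ℝ) (N : ℕ) (n : ℤ) :
    cellMeasure δ N n Set.univ = ENNReal.ofReal (2 * (δ * (N : ℝ)⁻¹)) := by
  rw [cellMeasure, Measure.restrict_apply_univ, Real.volume_Icc]
  congr 1
  ring

/-- The product of three cell measures. -/
def cellMeasure₃ (δ : ℝ) (N : ℕ) (n : ℤ × ℤ × ℤ) : Measure (ℝ × ℝ × ℝ) :=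
  (cellMeasure δ N n.1).prod ((cellMeasure δ N n.2.1).prod (cellMeasure δ N n.2.2))

instance (δ : ℝ) (N : ℕ) (n : ℤ × ℤ × ℤ) : IsFiniteMeasure (cellMeasure₃ δ N n) := by
  unfold cellMeasure₃; infer_instance

/-- The pairs of real triples whose linear and quadratic sums differ by at most `r`. -/
def nearSolutions (r : ℝ) : Set ((ℝ × ℝ × ℝ) × (ℝ × ℝ × ℝ)) :=
  {p | |linSum p.1 - linSum p.2| ≤ r ∧ |sqSum p.1 - sqSum p.2| ≤ r}

theorem cellMeasure₃_prod_nearSolutions_le (δ : ℝ) (N : ℕ) (m n : ℤ × ℤ × ℤ) (r : ℝ) :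
    ((cellMeasure₃ δ N m).prod (cellMeasure₃ δ N n)) (nearSolutions r) ≤
      ENNReal.ofReal (2 * r) * ENNReal.ofReal (2 * (δ * (N : ℝ)⁻¹)) ^ 5 := by
  have hsub : nearSolutions r ⊆
      {p | |p.1.1 + (fun v : ℝ × ℝ => v.1 + v.2) p.1.2 - linSum p.2| ≤ r} := by
    rintro ⟨⟨x, u⟩, y⟩ ⟨h, -⟩
    simpa [linSum, add_assoc] using h
  refine (measure_mono hsub).trans ((prod_measure_band_le (cellMeasure δ N m.1)
    Measure.restrict_le_self _ (cellMeasure₃ δ N n) (measurable_fst.add measurable_snd)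
    measurable_linSum r).trans
    (le_of_eq ?_))
  rw [cellMeasure₃, ← Set.univ_prod_univ, Measure.prod_prod, ← Set.univ_prod_univ,
    Measure.prod_prod, ← Set.univ_prod_univ, Measure.prod_prod]
  simp only [cellMeasure_univ]
  ring

theorem mem_cell_of_ae (δ : ℝ) (N : ℕ) (n : ℤ) :
    ∀ᵐ x ∂cellMeasure δ N n, |x - n * δ| ≤ δ * (N : ℝ)⁻¹ := by
  filter_upwards [ae_restrict_mem measurableSet_Icc] with x hx
  rw [abs_le]
  constructor <;> linarith [hx.1, hx.2]

theorem cellMeasure₃_prod_nearSolutions_eq_zero {δ c : ℝ} {N : ℕ} (hδ : 0 < δ) (hδ1 : δ ≤ 1)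
    (hN : 0 < N) (hc : 0 ≤ c) {K : ℕ} (hK : c + 18 ≤ K) {m n : ℤ × ℤ × ℤ}
    (hm : |m.1| ≤ N ∧ |m.2.1| ≤ N ∧ |m.2.2| ≤ N) (hn : |n.1| ≤ N ∧ |n.2.1| ≤ N ∧ |n.2.2| ≤ N)
    (h : ¬ (|m.1 + m.2.1 + m.2.2 - (n.1 + n.2.1 + n.2.2)| ≤ K ∧
      |m.1 ^ 2 + m.2.1 ^ 2 + m.2.2 ^ 2 - (n.1 ^ 2 + n.2.1 ^ 2 + n.2.2 ^ 2)| ≤ K)) :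
    ((cellMeasure₃ δ N m).prod (cellMeasure₃ δ N n)) (nearSolutions (c * δ ^ 2)) = 0 := by
  obtain ⟨m₁, m₂, m₃⟩ := m
  obtain ⟨n₁, n₂, n₃⟩ := n
  have hae : ∀ q : ℤ × ℤ × ℤ, ∀ᵐ u ∂cellMeasure₃ δ N q, |u.1 - q.1 * δ| ≤ δ * (N : ℝ)⁻¹ ∧
      |u.2.1 - q.2.1 * δ| ≤ δ * (N : ℝ)⁻¹ ∧ |u.2.2 - q.2.2 * δ| ≤ δ * (N : ℝ)⁻¹ := by
    intro q
    filter_upwards [Measure.quasiMeasurePreserving_fst.ae (mem_cell_of_ae δ N q.1),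
      Measure.quasiMeasurePreserving_snd.ae (Measure.quasiMeasurePreserving_fst.ae
        (mem_cell_of_ae δ N q.2.1)),
      Measure.quasiMeasurePreserving_snd.ae (Measure.quasiMeasurePreserving_snd.ae
        (mem_cell_of_ae δ N q.2.2))] with u h1 h2 h3
    exact ⟨h1, h2, h3⟩
  rw [measure_eq_zero_iff_ae_notMem]
  filter_upwards [Measure.quasiMeasurePreserving_fst.ae (hae (m₁, m₂, m₃)),
    Measure.quasiMeasurePreserving_snd.ae (hae (n₁, n₂, n₃))] with p hp hq hmem
  obtain ⟨⟨x₁, x₂, x₃⟩, y₁, y₂, y₃⟩ := p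
  have hcast : ∀ {k : ℤ}, |k| ≤ N → |(k : ℝ)| ≤ N := fun hk => by exact_mod_cast hk
  have key := abs_lattice_sums_le hδ hδ1 (by exact_mod_cast hN : (1 : ℝ) ≤ N) hc
    (n := ![(m₁ : ℝ), m₂, m₃, n₁, n₂, n₃]) (ω := ![x₁, x₂, x₃, y₁, y₂, y₃])
    (by
      intro i
      fin_cases i
      exacts [hcast hm.1, hcast hm.2.1, hcast hm.2.2, hcast hn.1, hcast hn.2.1, hcast hn.2.2])
    (by
      intro i
      fin_cases i
      exacts [hp.1, hp.2.1, hp.2.2, hq.1, hq.2.1, hq.2.2])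
    hmem.1 hmem.2
  have h1 : |(m₁ : ℝ) + m₂ + m₃ - (n₁ + n₂ + n₃)| ≤ K := key.1.trans hK
  have h2 : |(m₁ : ℝ) ^ 2 + m₂ ^ 2 + m₃ ^ 2 - (n₁ ^ 2 + n₂ ^ 2 + n₃ ^ 2)| ≤ K := key.2.trans hK
  exact h ⟨by exact_mod_cast h1, by exact_mod_cast h2⟩

theorem card_near_lattice_solutions_le {ε : ℝ} (hε : 0 < ε) (K : ℕ) :
    ∃ C : ℝ, 0 < C ∧ ∀ N : ℕ, 0 < N → ∀ S : Finset ((ℤ × ℤ × ℤ) × (ℤ × ℤ × ℤ)),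
      (∀ p ∈ S, ((|p.1.1| ≤ N ∧ |p.1.2.1| ≤ N ∧ |p.1.2.2| ≤ N) ∧
        (|p.2.1| ≤ N ∧ |p.2.2.1| ≤ N ∧ |p.2.2.2| ≤ N)) ∧
        |p.1.1 + p.1.2.1 + p.1.2.2 - (p.2.1 + p.2.2.1 + p.2.2.2)| ≤ K ∧
        |p.1.1 ^ 2 + p.1.2.1 ^ 2 + p.1.2.2 ^ 2 - (p.2.1 ^ 2 + p.2.2.1 ^ 2 + p.2.2.2 ^ 2)| ≤ K) →
      (S.card : ℝ) ≤ C * (N : ℝ) ^ (3 + ε) := by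
  classical
  obtain ⟨C, hC, hcard⟩ := card_vinogradovSet_le hε K
  set I := Finset.Icc (-(K : ℤ)) K ×ˢ Finset.Icc (-(K : ℤ)) K with hI
  refine ⟨(I.card + 1) * C, by positivity, fun N hN S hS => ?_⟩
  have hsub : S ⊆ I.biUnion fun q => vinogradovSet N q.1 q.2 := by
    rintro ⟨⟨x₁, x₂, x₃⟩, y₁, y₂, y₃⟩ hp
    obtain ⟨hbox, h1, h2⟩ := hS _ hp
    simp only [abs_le] at hbox h1 h2
    rw [Finset.mem_biUnion]
    refine ⟨(_, _), ?_, mem_vinogradovSet.mpr ⟨?_, rfl, rfl⟩⟩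
    · simp only [hI, Finset.mem_product, Finset.mem_Icc]
      exact ⟨h1, h2⟩
    · simpa only [Finset.mem_Icc] using hbox
  calc (S.card : ℝ) ≤ ((∑ q ∈ I, (vinogradovSet N q.1 q.2).card : ℕ) : ℝ) := by
        exact_mod_cast (Finset.card_le_card hsub).trans Finset.card_biUnion_le
    _ = ∑ q ∈ I, ((vinogradovSet N q.1 q.2).card : ℝ) := by push_cast; rfl
    _ ≤ ∑ q ∈ I, C * (N : ℝ) ^ (3 + ε) := by
        refine Finset.sum_le_sum fun q hq => ?_
        rw [hI, Finset.mem_product, Finset.mem_Icc, Finset.mem_Icc, ← abs_le, ← abs_le] at hq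
        exact hcard N hN _ _ hq.1 hq.2
    _ = I.card * C * (N : ℝ) ^ (3 + ε) := by rw [Finset.sum_const, nsmul_eq_mul, mul_assoc]
    _ ≤ _ := by gcongr; linarith

theorem prod_nearSolutions_le {ε c : ℝ} (hε : 0 < ε) (hc : 0 ≤ c) :
    ∃ C : ℝ, 0 < C ∧ ∀ (δ : ℝ) (N : ℕ), 0 < δ → δ ≤ 1 → 0 < N →
      ∀ (μ : Measure ℝ) [IsFiniteMeasure μ],
      μ ≤ Measure.sum (fun n : Finset.Icc (-(N : ℤ)) N => cellMeasure δ N n) →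
      ((μ.prod (μ.prod μ)).prod (μ.prod (μ.prod μ))) (nearSolutions (c * δ ^ 2)) ≤
        ENNReal.ofReal (C * (N : ℝ) ^ (-2 + ε) * δ ^ 7) := by
  classical
  set K : ℕ := ⌈c + 18⌉₊ with hK
  obtain ⟨C, hC, hcard⟩ := card_near_lattice_solutions_le hε K
  refine ⟨64 * (C * (c + 1)), by positivity, fun δ N hδ hδ1 hN μ _ hμ => ?_⟩
  set E := nearSolutions (c * δ ^ 2) with hE
  set s := Finset.Icc (-(N : ℤ)) N with hs
  set T := s × s × s with hT
  let v : T → ℤ × ℤ × ℤ := fun t => (t.1, t.2.1, t.2.2)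
  set b : ℝ≥0∞ := ENNReal.ofReal (2 * (c * δ ^ 2)) * ENNReal.ofReal (2 * (δ * (N : ℝ)⁻¹)) ^ 5
    with hb
  set L := Measure.sum (fun n : s => cellMeasure δ N n) with hL
  have hL3 : L.prod (L.prod L) = Measure.sum fun t : T => cellMeasure₃ δ N (v t) := by
    rw [hL, Measure.prod_sum, Measure.prod_sum]
    rfl
  have hv : ∀ t : T, |(v t).1| ≤ N ∧ |(v t).2.1| ≤ N ∧ |(v t).2.2| ≤ N := fun t =>
    ⟨abs_le.mpr (Finset.mem_Icc.mp t.1.2), abs_le.mpr (Finset.mem_Icc.mp t.2.1.2),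
      abs_le.mpr (Finset.mem_Icc.mp t.2.2.2)⟩
  have hvinj : Function.Injective (Prod.map v v) := by
    refine Function.Injective.prodMap ?_ ?_ <;>
    · rintro ⟨⟨_, _⟩, ⟨_, _⟩, ⟨_, _⟩⟩ ⟨⟨_, _⟩, ⟨_, _⟩, ⟨_, _⟩⟩ h
      simp only [v, Prod.mk.injEq] at h
      obtain ⟨rfl, rfl, rfl⟩ := h
      rfl
  let P : T × T → Prop := fun p =>
    |(v p.1).1 + (v p.1).2.1 + (v p.1).2.2 - ((v p.2).1 + (v p.2).2.1 + (v p.2).2.2)| ≤ K ∧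
    |(v p.1).1 ^ 2 + (v p.1).2.1 ^ 2 + (v p.1).2.2 ^ 2 -
      ((v p.2).1 ^ 2 + (v p.2).2.1 ^ 2 + (v p.2).2.2 ^ 2)| ≤ K
  have hN1 : (0 : ℝ) < N := by exact_mod_cast hN
  have hcardP : ((Finset.univ.filter P).card : ℝ) ≤ C * (N : ℝ) ^ (3 + ε) := by
    rw [← Finset.card_image_of_injective _ hvinj]
    refine hcard N hN _ fun p hp => ?_
    obtain ⟨t, ht, rfl⟩ := Finset.mem_image.mp hp
    exact ⟨⟨hv _, hv _⟩, (Finset.mem_filter.mp ht).2⟩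
  have hμ3 : μ.prod (μ.prod μ) ≤ L.prod (L.prod L) :=
    Measure.prod_mono hμ (Measure.prod_mono hμ hμ)
  calc ((μ.prod (μ.prod μ)).prod (μ.prod (μ.prod μ))) E
      ≤ ((L.prod (L.prod L)).prod (L.prod (L.prod L))) E := Measure.prod_mono hμ3 hμ3 E
    _ = ∑ p : T × T, ((cellMeasure₃ δ N (v p.1)).prod (cellMeasure₃ δ N (v p.2))) E := by
        rw [hL3, Measure.prod_sum, Measure.sum_apply_of_countable, tsum_fintype]
    _ ≤ ∑ p : T × T, if P p then b else 0 := by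
        refine Finset.sum_le_sum fun p _ => ?_
        split_ifs with hP
        · exact cellMeasure₃_prod_nearSolutions_le δ N _ _ _
        · exact (cellMeasure₃_prod_nearSolutions_eq_zero hδ hδ1 hN hc (Nat.le_ceil _) (hv _)
            (hv _) hP).le
    _ = (Finset.univ.filter P).card * b := by
        rw [← Finset.sum_filter, Finset.sum_const, nsmul_eq_mul]
    _ ≤ ENNReal.ofReal (C * (N : ℝ) ^ (3 + ε)) * b := by
        gcongr
        rw [← ENNReal.ofReal_natCast]
        exact ENNReal.ofReal_le_ofReal hcardP
    _ = ENNReal.ofReal (C * (N : ℝ) ^ (3 + ε) * (2 * (c * δ ^ 2) * (2 * (δ * (N : ℝ)⁻¹)) ^ 5)) := by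
        rw [hb, ← ENNReal.ofReal_pow (by positivity), ← ENNReal.ofReal_mul (by positivity),
          ← ENNReal.ofReal_mul (by positivity)]
    _ ≤ _ := by
        refine ENNReal.ofReal_le_ofReal ?_
        have hpow : (N : ℝ) ^ (3 + ε) * ((N : ℝ)⁻¹) ^ 5 = (N : ℝ) ^ (-2 + ε) := by
          rw [inv_pow, ← Real.rpow_natCast, ← Real.rpow_neg hN1.le, ← Real.rpow_add hN1]
          congr 1
          push_cast
          ring
        calc C * (N : ℝ) ^ (3 + ε) * (2 * (c * δ ^ 2) * (2 * (δ * (N : ℝ)⁻¹)) ^ 5)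
            = 64 * (C * c) * ((N : ℝ) ^ (3 + ε) * ((N : ℝ)⁻¹) ^ 5) * δ ^ 7 := by ring
          _ = 64 * (C * c) * (N : ℝ) ^ (-2 + ε) * δ ^ 7 := by rw [hpow]
          _ ≤ _ := by gcongr; linarith

end ProductCount

section Bundle

/-- The real density of `bundleFn`. -/
def bundleDensity (δ : ℝ) (N : ℕ) (Θ : ℝ → ℝ) (ω : ℝ) : ℝ :=
  ∑ n ∈ Finset.Icc (-(N : ℤ)) N, Θ (ω - n * δ)

/-- The measure on `[-1, 1]` with density `bundleDensity`. -/
def bundleMeasure (δ : ℝ) (N : ℕ) (Θ : ℝ → ℝ) : Measure ℝ :=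
  (volume.restrict (Icc (-1) 1)).withDensity fun ω => ENNReal.ofReal (bundleDensity δ N Θ ω)

theorem continuous_bundleDensity {Θ : ℝ → ℝ} (hΘ : Continuous Θ) (δ : ℝ) (N : ℕ) :
    Continuous (bundleDensity δ N Θ) := by
  unfold bundleDensity
  fun_prop

theorem isFiniteMeasure_bundleMeasure {Θ : ℝ → ℝ} (hΘ : Continuous Θ) (δ : ℝ) (N : ℕ) :
    IsFiniteMeasure (bundleMeasure δ N Θ) :=
  isFiniteMeasure_withDensity_ofReal
    ((continuous_bundleDensity hΘ δ N).integrableOn_Icc).hasFiniteIntegral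

theorem extOp_bundleFn_eq {R : ℝ} {N : ℕ} {Θ : ℝ → ℝ} (hΘ : Continuous Θ) (hΘ0 : ∀ ω, 0 ≤ Θ ω)
    (z : ℝ × ℝ) :
    extOp (bundleFn R N Θ) z =
      ∫ ω, Complex.exp (Complex.I * ((ω ^ 2 * z.2 + ω * z.1 : ℝ) : ℂ))
        ∂bundleMeasure (R ^ (-(1 : ℝ) / 2)) N Θ := by
  rw [bundleMeasure, integral_withDensity_eq_integral_toReal_smul
    (continuous_bundleDensity hΘ _ N).measurable.ennreal_ofReal
    (Filter.Eventually.of_forall fun _ => ENNReal.ofReal_lt_top), extOp]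
  refine integral_congr_ae (Filter.Eventually.of_forall fun ω => ?_)
  have h0 : 0 ≤ bundleDensity (R ^ (-(1 : ℝ) / 2)) N Θ ω := Finset.sum_nonneg fun n _ => hΘ0 _
  simp only [ENNReal.toReal_ofReal h0, Complex.real_smul]
  rw [mul_comm]
  rfl

theorem bundleMeasure_le {δ : ℝ} {N : ℕ} {Θ : ℝ → ℝ} (hΘ0 : ∀ ω, 0 ≤ Θ ω)
    (hΘ1 : ∀ ω, Θ ω ≤ 1)
    (hΘs : Function.support Θ ⊆ Icc (-(δ * (N : ℝ)⁻¹)) (δ * (N : ℝ)⁻¹)) :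
    bundleMeasure δ N Θ ≤
      Measure.sum fun n : Finset.Icc (-(N : ℤ)) N => cellMeasure δ N n := by
  let I : ℤ → Set ℝ := fun n => Icc (n * δ - δ * (N : ℝ)⁻¹) (n * δ + δ * (N : ℝ)⁻¹)
  have hpt : ∀ (n : ℤ) (ω : ℝ), ENNReal.ofReal (Θ (ω - n * δ)) ≤ (I n).indicator 1 ω := by
    intro n ω
    by_cases h : ω ∈ I n
    · rw [Set.indicator_of_mem h]
      exact ENNReal.ofReal_le_one.mpr (hΘ1 _)
    · have : Θ (ω - n * δ) = 0 := by
        by_contra hne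
        obtain ⟨h1, h2⟩ := hΘs hne
        exact h ⟨by linarith, by linarith⟩
      rw [this, ENNReal.ofReal_zero]
      exact zero_le
  refine Measure.le_iff.mpr fun A hA => ?_
  rw [bundleMeasure, withDensity_apply _ hA, Measure.sum_apply_of_countable, tsum_fintype]
  calc ∫⁻ ω in A, ENNReal.ofReal (bundleDensity δ N Θ ω) ∂(volume.restrict (Icc (-1) 1))
      ≤ ∫⁻ ω in A, ∑ n ∈ Finset.Icc (-(N : ℤ)) N, (I n).indicator 1 ω := by
        refine lintegral_mono' (Measure.restrict_mono_measure Measure.restrict_le_self _)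
          fun ω => ?_
        rw [bundleDensity, ENNReal.ofReal_sum_of_nonneg fun n _ => hΘ0 _]
        exact Finset.sum_le_sum fun n _ => hpt n ω
    _ = ∑ n ∈ Finset.Icc (-(N : ℤ)) N, cellMeasure δ N n A := by
        rw [lintegral_finsetSum _ fun n _ => measurable_one.indicator measurableSet_Icc]
        refine Finset.sum_congr rfl fun n _ => ?_
        rw [lintegral_indicator_one measurableSet_Icc, cellMeasure,
          Measure.restrict_apply measurableSet_Icc, Measure.restrict_apply hA, Set.inter_comm]
    _ ≤ _ := (Finset.sum_coe_sort _ fun n => cellMeasure δ N n A).ge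

theorem integral_exp_pow_three (μ : Measure ℝ) [SFinite μ] (z : ℝ × ℝ) :
    (∫ ω, Complex.exp (Complex.I * ((ω ^ 2 * z.2 + ω * z.1 : ℝ) : ℂ)) ∂μ) ^ 3 =
      ∫ u, Complex.exp (Complex.I * ((sqSum u * z.2 + linSum u * z.1 : ℝ) : ℂ))
        ∂(μ.prod (μ.prod μ)) := by
  set k : ℝ → ℂ := fun ω => Complex.exp (Complex.I * ((ω ^ 2 * z.2 + ω * z.1 : ℝ) : ℂ)) with hk
  have h : ∀ u : ℝ × ℝ × ℝ,
      Complex.exp (Complex.I * ((sqSum u * z.2 + linSum u * z.1 : ℝ) : ℂ)) =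
        k u.1 * (k u.2.1 * k u.2.2) := fun u => by
    simp only [hk, sqSum, linSum, ← Complex.exp_add]
    congr 1
    push_cast
    ring
  simp_rw [h]
  rw [integral_prod_mul k (fun v : ℝ × ℝ => k v.1 * k v.2), integral_prod_mul k k]
  ring

theorem lintegral_extOp_bundleFn_pow_six_le {ε : ℝ} (hε : 0 < ε) :
    ∃ C : ℝ, 0 < C ∧ ∀ R : ℝ, 1 ≤ R → ∀ N : ℕ, 0 < N → ∀ Θ : ℝ → ℝ, IsBundleBump R N Θ →
      ∫⁻ z in Metric.ball (0 : ℝ × ℝ) R, ‖extOp (bundleFn R N Θ) z‖ₑ ^ 6 ≤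
        ENNReal.ofReal (C * (N : ℝ) ^ (-2 + ε) * R ^ (-(3 : ℝ) / 2)) := by
  obtain ⟨φ, c, hc, hφc, hφi, hφ0, hφ1, hφ⟩ := exists_band_limited_majorant
  obtain ⟨C, hC, hcount⟩ := prod_nearSolutions_le hε hc.le
  refine ⟨(∫ x, φ x) ^ 2 * C + 1, by positivity, fun R hR N hN Θ hΘ => ?_⟩
  obtain ⟨hsmooth, hbd, -, hsupp⟩ := hΘ
  have hR0 : 0 < R := by linarith
  set δ : ℝ := R ^ (-(1 : ℝ) / 2) with hδ
  have hδ0 : 0 < δ := by positivity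
  have hδ1 : δ ≤ 1 := Real.rpow_le_one_of_one_le_of_nonpos hR (by norm_num)
  have hδ2 : c * δ ^ 2 = c / R := by
    rw [hδ, ← Real.rpow_natCast, ← Real.rpow_mul hR0.le]
    norm_num [Real.rpow_neg_one, div_eq_mul_inv]
  set μ := bundleMeasure δ N Θ with hμ
  have : IsFiniteMeasure μ := isFiniteMeasure_bundleMeasure hsmooth.continuous δ N
  have hsieve := lintegral_ball_enorm_sq_le (μ.prod (μ.prod μ)) measurable_linSum measurable_sqSum
    hR0 hφc hφi hφ0 hφ1 hφ
  have hsol := hcount δ N hδ0 hδ1 hN μ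
    (bundleMeasure_le (fun ω => (hbd ω).1) (fun ω => (hbd ω).2) hsupp)
  rw [hδ2] at hsol
  calc ∫⁻ z in Metric.ball (0 : ℝ × ℝ) R, ‖extOp (bundleFn R N Θ) z‖ₑ ^ 6
      = ∫⁻ z in Metric.ball (0 : ℝ × ℝ) R, ‖∫ u, Complex.exp (Complex.I *
          ((sqSum u * z.2 + linSum u * z.1 : ℝ) : ℂ)) ∂(μ.prod (μ.prod μ))‖ₑ ^ 2 := by
        refine lintegral_congr fun z => ?_
        rw [← integral_exp_pow_three, extOp_bundleFn_eq hsmooth.continuous fun ω => (hbd ω).1,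
          enorm_pow, ← pow_mul]
    _ ≤ ENNReal.ofReal ((R * ∫ x, φ x) ^ 2) *
          ENNReal.ofReal (C * (N : ℝ) ^ (-2 + ε) * δ ^ 7) :=
        hsieve.trans (mul_le_mul_right hsol _)
    _ = ENNReal.ofReal ((∫ x, φ x) ^ 2 * C * (N : ℝ) ^ (-2 + ε) * (R ^ 2 * δ ^ 7)) := by
        rw [← ENNReal.ofReal_mul (by positivity)]
        congr 1
        ring
    _ ≤ _ := by
        have hpow : R ^ 2 * δ ^ 7 = R ^ (-(3 : ℝ) / 2) := by
          rw [hδ, ← Real.rpow_natCast, ← Real.rpow_natCast, ← Real.rpow_mul hR0.le,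
            ← Real.rpow_add hR0]
          norm_num
        rw [hpow]
        refine ENNReal.ofReal_le_ofReal ?_
        gcongr
        linarith

end Bundle

/-- **`L⁶` upper bound for the bundle scenario** (equation (6.10) of the paper):
for every `ε > 0` there is a constant `C_ε` such that for all `R ≥ 1` and all
positive integers `N < R^{1/2}`,
`‖Ef_{R,N}‖_{L⁶(B_R)} ≤ C_ε · R^{-1/4 + ε} · N^{-1/3}`. -/
theorem bundle_L6_upper_bound (ε : ℝ) (hε : 0 < ε) :
    ∃ C : ℝ, ∀ R : ℝ, 1 ≤ R → ∀ N : ℕ, 0 < N →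
      (N : ℝ) < R ^ ((1 : ℝ) / 2) → ∀ Θ : ℝ → ℝ, IsBundleBump R N Θ →
      LpBall (extOp (bundleFn R N Θ)) 6 R ≤
        ENNReal.ofReal (C * R ^ (-(1 : ℝ) / 4 + ε) * (N : ℝ) ^ (-(1 : ℝ) / 3)) := by
  obtain ⟨C, hC, hbound⟩ := lintegral_extOp_bundleFn_pow_six_le (by positivity : 0 < 12 * ε)
  refine ⟨C ^ ((1 : ℝ) / 6), fun R hR N hN hNR Θ hΘ => ?_⟩
  have hR0 : 0 < R := by linarith
  have hN0 : (0 : ℝ) < N := by exact_mod_cast hN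
  have hNε : (N : ℝ) ^ (-2 + 12 * ε) ≤ (N : ℝ) ^ (-2 : ℝ) * R ^ (6 * ε) := by
    rw [Real.rpow_add hN0]
    gcongr
    calc (N : ℝ) ^ (12 * ε) ≤ (R ^ ((1 : ℝ) / 2)) ^ (12 * ε) := by gcongr
      _ = R ^ (6 * ε) := by
        rw [← Real.rpow_mul hR0.le]
        congr 1
        ring
  rw [LpBall, eLpNorm_eq_lintegral_rpow_enorm_toReal (by norm_num) ENNReal.ofReal_ne_top,
    ENNReal.toReal_ofReal (by norm_num)]
  calc (∫⁻ z in Metric.ball (0 : ℝ × ℝ) R, ‖extOp (bundleFn R N Θ) z‖ₑ ^ (6 : ℝ)) ^ ((1 : ℝ) / 6)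
      ≤ ENNReal.ofReal (C * ((N : ℝ) ^ (-2 : ℝ) * R ^ (6 * ε)) * R ^ (-(3 : ℝ) / 2)) ^
          ((1 : ℝ) / 6) := by
        gcongr
        refine le_trans (le_of_eq ?_) ((hbound R hR N hN Θ hΘ).trans
          (ENNReal.ofReal_le_ofReal (by gcongr)))
        norm_cast
    _ = _ := by
        rw [ENNReal.ofReal_rpow_of_nonneg (by positivity) (by norm_num)]
        congr 1
        rw [Real.mul_rpow (by positivity) (by positivity),
          Real.mul_rpow (by positivity) (by positivity),
          Real.mul_rpow (by positivity) (by positivity), ← Real.rpow_mul hN0.le,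
          ← Real.rpow_mul hR0.le, ← Real.rpow_mul hR0.le, Real.rpow_add hR0]
        ring_nf

end
end
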